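/- Stability of the Gaussian L²-Poincaré inequality (Corollary 3.12): Let Ω ⊂ ℝⁿ (n ≥ 2) be an open bounded convex set of diameter diam(Ω), and let u₁^γ be a first eigenfunction of the Ornstein–Uhlenbeck operator on Ω with Dirichlet boundary conditions (positive in Ω, with log u₁^γ concave). Then for every real-valued smooth function u with compact support in Ω: ∫_Ω |∇u|² dγ − λ₁(2,Ω,γ) ∫_Ω |u|² dγ ≥ (π / diam(Ω))² · inf_{c∈ℝ} ∫_Ω |u − c·u₁^γ|² dγ. -/

import Mathlib

open MeasureTheory Real Filter
open scoped RealInnerProductSpace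

/-- The standard Gaussian probability measure `dγ = (2π)^{-n/2} e^{-|x|²/2} dx` on `ℝⁿ`. -/
noncomputable def gaussMeasure (n : ℕ) : Measure (EuclideanSpace ℝ (Fin n)) :=
  volume.withDensity fun x =>
    ENNReal.ofReal ((2 * Real.pi) ^ (-(n : ℝ) / 2) * Real.exp (-‖x‖ ^ 2 / 2))

/-- The first Dirichlet eigenvalue of the Ornstein–Uhlenbeck operator on `Ω`, defined as the
infimum of the Gaussian Rayleigh quotients over smooth nontrivial functions compactly
supported in `Ω`. -/
noncomputable def lambda1Gauss (n : ℕ) (Ω : Set (EuclideanSpace ℝ (Fin n))) : ℝ :=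
  sInf { r : ℝ | ∃ u : EuclideanSpace ℝ (Fin n) → ℝ,
    ContDiff ℝ (⊤ : ℕ∞) u ∧ HasCompactSupport u ∧ tsupport u ⊆ Ω ∧ u ≠ 0 ∧
    r = (∫ x in Ω, ‖gradient u x‖ ^ 2 ∂(gaussMeasure n)) /
        (∫ x in Ω, |u x| ^ 2 ∂(gaussMeasure n)) }

/-- Sharp Poincaré inequality on an interval with a `C²` log-concave weight `exp (-φ)`. -/
theorem intervalIntegral_poincare_exp_neg {a b k : ℝ} (hab : a < b) (hk : 0 < k)
    (hkπ : k * (b - a) < π) {φ φ' φ'' f f' : ℝ → ℝ}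
    (hφ : ∀ x, HasDerivAt φ (φ' x) x) (hφ' : ∀ x, HasDerivAt φ' (φ'' x) x)
    (hφ'' : Continuous φ'') (hconv : ∀ x ∈ Set.Icc a b, 0 ≤ φ'' x)
    (hf : ∀ x, HasDerivAt f (f' x) x) (hf' : Continuous f')
    (hmean : ∫ x in a..b, f x * exp (-φ x) = 0) :
    k ^ 2 * ∫ x in a..b, f x ^ 2 * exp (-φ x) ≤ ∫ x in a..b, f' x ^ 2 * exp (-φ x) := by
  have cφ : Continuous φ := continuous_iff_continuousAt.2 fun x => (hφ x).continuousAt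
  have cφ' : Continuous φ' := continuous_iff_continuousAt.2 fun x => (hφ' x).continuousAt
  have cf : Continuous f := continuous_iff_continuousAt.2 fun x => (hf x).continuousAt
  set η : ℝ := (π - k * (b - a)) / 2 with hη
  set F : ℝ → ℝ := fun t => ∫ x in a..t, f x * exp (-φ x) with hF
  have cint : Continuous fun x => f x * exp (-φ x) := by fun_prop
  have hFd : ∀ x, HasDerivAt F (f x * exp (-φ x)) x := fun x =>
    intervalIntegral.integral_hasDerivAt_right (cint.intervalIntegrable _ _)
      (cint.stronglyMeasurableAtFilter _ _) cint.continuousAt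
  have cF : Continuous F := continuous_iff_continuousAt.2 fun x => (hFd x).continuousAt
  have hFa : F a = 0 := by simp [hF]
  have hFb : F b = 0 := hmean
  set S : ℝ → ℝ := fun x => sin (k * (x - a) + η) with hS
  set C : ℝ → ℝ := fun x => cos (k * (x - a) + η) with hC
  have hSpos : ∀ x ∈ Set.Icc a b, 0 < S x := by
    intro x hx
    apply sin_pos_of_pos_of_lt_pi
    · have : 0 ≤ k * (x - a) := mul_nonneg hk.le (by linarith [hx.1])
      rw [hη]; linarith
    · have : k * (x - a) ≤ k * (b - a) := mul_le_mul_of_nonneg_left (by linarith [hx.2]) hk.le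
      rw [hη]; linarith
  have hinner : ∀ x, HasDerivAt (fun x => k * (x - a) + η) k x := fun x => by
    simpa using (((hasDerivAt_id x).sub_const a).const_mul k).add_const η
  have hSd : ∀ x, HasDerivAt S (C x * k) x := fun x => (hinner x).sin
  have hCd : ∀ x, HasDerivAt C (-S x * k) x := fun x => (hinner x).cos
  have cS : Continuous S := by fun_prop
  have cC : Continuous C := by fun_prop
  set q : ℝ → ℝ := fun x => -(φ' x) / 2 + k * (C x / S x) with hq
  set q' : ℝ → ℝ := fun x => -(φ'' x) / 2 + k * ((-S x * k * S x - C x * (C x * k)) / S x ^ 2)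
    with hq'
  have hqd : ∀ x ∈ Set.Icc a b, HasDerivAt q (q' x) x := fun x hx =>
    ((hφ' x).neg.div_const 2).add (((hCd x).div (hSd x) (hSpos x hx).ne').const_mul k)
  set D : ℝ → ℝ := fun x => k ^ 2 * (((2 * F x * (f x * exp (-φ x))) * q x + F x ^ 2 * q' x)
      * exp (φ x) + (F x ^ 2 * q x) * (exp (φ x) * φ' x))
      - 2 * k ^ 2 * (f' x * F x + f x * (f x * exp (-φ x))) with hD
  have hGd : ∀ x ∈ Set.uIcc a b, HasDerivAt
      (fun x => k ^ 2 * (F x ^ 2 * q x * exp (φ x)) - 2 * k ^ 2 * (f x * F x)) (D x) x := by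
    intro x hx
    rw [Set.uIcc_of_le hab.le] at hx
    have h1 := (hFd x).pow 2
    have h2 := ((((h1.mul (hqd x hx)).mul (hφ x).exp).const_mul (k ^ 2)).sub
      (((hf x).mul (hFd x)).const_mul (2 * k ^ 2)))
    exact h2.congr_deriv (by simp [hD])
  have cSn : ∀ x ∈ Set.Icc a b, S x ≠ 0 := fun x hx => (hSpos x hx).ne'
  have cD : ContinuousOn D (Set.Icc a b) := by
    have cq : ContinuousOn q (Set.Icc a b) :=
      fun x hx => (hqd x hx).continuousAt.continuousWithinAt
    have cq' : ContinuousOn q' (Set.Icc a b) := by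
      refine ContinuousOn.add (by fun_prop) (ContinuousOn.mul (by fun_prop) ?_)
      exact ContinuousOn.div (by fun_prop) (by fun_prop) fun x hx => pow_ne_zero 2 (cSn x hx)
    fun_prop
  have hDi : IntervalIntegrable D volume a b := by
    apply ContinuousOn.intervalIntegrable
    rwa [Set.uIcc_of_le hab.le]
  have hInt := intervalIntegral.integral_eq_sub_of_hasDerivAt hGd hDi
  simp only [hFa, hFb] at hInt
  norm_num at hInt
  have cl : Continuous fun x => f' x ^ 2 * exp (-φ x) - k ^ 2 * (f x ^ 2 * exp (-φ x)) := by
    fun_prop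
  have hle := intervalIntegral.integral_mono_on hab.le hDi (cl.intervalIntegrable a b)
    (fun x hx => by
      have hs := hSpos x hx
      have hE : exp (-φ x) * exp (φ x) = 1 := by rw [← exp_add]; simp
      have hP : 0 < exp (φ x) := exp_pos _
      have hR : exp (-φ x) = (exp (φ x))⁻¹ := exp_neg _
      have hqq : - q x ^ 2 - q' x - q x * φ' x - k ^ 2 = φ'' x / 2 + φ' x ^ 2 / 4 := by
        simp only [hq, hq']
        field_simp
        ring
      have hnn : 0 ≤ φ'' x / 2 + φ' x ^ 2 / 4 := by
        have := hconv x hx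
        positivity
      have key : f' x ^ 2 * exp (-φ x) - k ^ 2 * (f x ^ 2 * exp (-φ x)) - D x =
          exp (-φ x) * (f' x + k ^ 2 * F x * exp (φ x)) ^ 2
          + k ^ 2 * (exp (-φ x) * (f x - F x * q x * exp (φ x)) ^ 2
            + F x ^ 2 * exp (φ x) * (φ'' x / 2 + φ' x ^ 2 / 4)) := by
        rw [← hqq]
        simp only [hD, hR]
        field_simp
        ring
      have : 0 ≤ f' x ^ 2 * exp (-φ x) - k ^ 2 * (f x ^ 2 * exp (-φ x)) - D x := by
        rw [key]
        positivity
      linarith)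
  rw [hInt, intervalIntegral.integral_sub, intervalIntegral.integral_const_mul] at hle
  · linarith
  · exact Continuous.intervalIntegrable (by fun_prop) _ _
  · exact Continuous.intervalIntegrable (by fun_prop) _ _

/-- Forward average of `g` over `[t, t + s]`. -/
noncomputable def forwardAverage (g : ℝ → ℝ) (s t : ℝ) : ℝ := ∫ r in (0 : ℝ)..1, g (t + s * r)

theorem continuous_forwardAverage {X : Type*} [TopologicalSpace X] [FirstCountableTopology X]
    {G : X → ℝ → ℝ}
    (hG : Continuous (Function.uncurry G)) {s t : X → ℝ} (hs : Continuous s) (ht : Continuous t) :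
    Continuous fun x => forwardAverage (G x) (s x) (t x) := by
  unfold forwardAverage
  apply intervalIntegral.continuous_parametric_intervalIntegral_of_continuous' (μ := volume)
  have : Continuous fun p : X × ℝ => Function.uncurry G (p.1, t p.1 + s p.1 * p.2) := by fun_prop
  exact this

theorem hasDerivAt_forwardAverage {g : ℝ → ℝ} (hg : Continuous g) {s : ℝ} (hs : s ≠ 0) (t : ℝ) :
    HasDerivAt (forwardAverage g s) ((g (t + s) - g t) / s) t := by
  have h1 : forwardAverage g s = fun t =>
      s⁻¹ * ((∫ x in (0 : ℝ)..(t + s), g x) - ∫ x in (0 : ℝ)..t, g x) := by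
    ext t
    have := intervalIntegral.integral_comp_add_mul (a := 0) (b := 1) g hs t
    rw [forwardAverage, this, intervalIntegral.integral_interval_sub_left
      (hg.intervalIntegrable _ _) (hg.intervalIntegrable _ _)]
    simp
  have h2 : ∀ y, HasDerivAt (fun u => ∫ x in (0 : ℝ)..u, g x) (g y) y := fun y =>
    intervalIntegral.integral_hasDerivAt_right (hg.intervalIntegrable _ _)
      (hg.stronglyMeasurableAtFilter _ _) hg.continuousAt
  have h3 := (((h2 (t + s)).comp_add_const t s).sub (h2 t)).const_mul s⁻¹
  rw [h1]
  exact h3.congr_deriv (by field_simp)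

/-- Variance form of `intervalIntegral_poincare_exp_neg`. -/
theorem intervalIntegral_variance_exp_neg {a b k : ℝ} (hab : a < b) (hk : 0 < k)
    (hkπ : k * (b - a) < π) {φ φ' φ'' f f' : ℝ → ℝ}
    (hφ : ∀ x, HasDerivAt φ (φ' x) x) (hφ' : ∀ x, HasDerivAt φ' (φ'' x) x)
    (hφ'' : Continuous φ'') (hconv : ∀ x ∈ Set.Icc a b, 0 ≤ φ'' x)
    (hf : ∀ x, HasDerivAt f (f' x) x) (hf' : Continuous f') :
    k ^ 2 * ((∫ x in a..b, f x ^ 2 * exp (-φ x)) * (∫ x in a..b, exp (-φ x))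
      - (∫ x in a..b, f x * exp (-φ x)) ^ 2)
      ≤ (∫ x in a..b, exp (-φ x)) * ∫ x in a..b, f' x ^ 2 * exp (-φ x) := by
  have cφ : Continuous φ := continuous_iff_continuousAt.2 fun x => (hφ x).continuousAt
  have cf : Continuous f := continuous_iff_continuousAt.2 fun x => (hf x).continuousAt
  set m := ∫ x in a..b, exp (-φ x)
  set A := ∫ x in a..b, f x * exp (-φ x)
  set B := ∫ x in a..b, f x ^ 2 * exp (-φ x)
  have hm : 0 < m := intervalIntegral.intervalIntegral_pos_of_pos
    (Continuous.intervalIntegrable (by fun_prop) _ _) (fun x => exp_pos _) hab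
  have i0 : IntervalIntegrable (fun x => exp (-φ x)) volume a b :=
    Continuous.intervalIntegrable (by fun_prop) _ _
  have i1 : IntervalIntegrable (fun x => f x * exp (-φ x)) volume a b :=
    Continuous.intervalIntegrable (by fun_prop) _ _
  have i2 : IntervalIntegrable (fun x => f x ^ 2 * exp (-φ x)) volume a b :=
    Continuous.intervalIntegrable (by fun_prop) _ _
  have e1 : ∫ x in a..b, (f x - A / m) * exp (-φ x) = 0 := by
    simp_rw [sub_mul]
    rw [intervalIntegral.integral_sub i1 (i0.const_mul _), intervalIntegral.integral_const_mul]
    change A - A / m * m = 0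
    field_simp
    simp
  have e2 : ∫ x in a..b, (f x - A / m) ^ 2 * exp (-φ x) = B - A ^ 2 / m := by
    have : ∀ x, (f x - A / m) ^ 2 * exp (-φ x) = f x ^ 2 * exp (-φ x)
        - (2 * (A / m)) * (f x * exp (-φ x)) + (A / m) ^ 2 * exp (-φ x) := fun x => by ring
    simp_rw [this]
    rw [intervalIntegral.integral_add (i2.sub (i1.const_mul _)) (i0.const_mul _),
      intervalIntegral.integral_sub i2 (i1.const_mul _), intervalIntegral.integral_const_mul,
      intervalIntegral.integral_const_mul]
    change B - 2 * (A / m) * A + (A / m) ^ 2 * m = _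
    field_simp
    ring
  have key := intervalIntegral_poincare_exp_neg hab hk hkπ hφ hφ' hφ'' hconv
    (fun x => (hf x).sub_const (A / m)) hf' e1
  rw [e2] at key
  calc k ^ 2 * (B * m - A ^ 2) = m * (k ^ 2 * (B - A ^ 2 / m)) := by field_simp
    _ ≤ _ := mul_le_mul_of_nonneg_left key hm.le

/-- Sharp Poincaré inequality on an interval with a weight `exp (-φ)`, `φ` convex and
continuous. -/
theorem intervalIntegral_variance_exp_neg_of_convexOn {a b k : ℝ} (hab : a < b) (hk : 0 < k)
    (hkπ : k * (b - a) < π) {φ f f' : ℝ → ℝ}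
    (hφ : Continuous φ) (hconv : ConvexOn ℝ (Set.Icc a b) φ)
    (hf : ∀ x, HasDerivAt f (f' x) x) (hf' : Continuous f') :
    k ^ 2 * ((∫ x in a..b, f x ^ 2 * exp (-φ x)) * (∫ x in a..b, exp (-φ x))
      - (∫ x in a..b, f x * exp (-φ x)) ^ 2)
      ≤ (∫ x in a..b, exp (-φ x)) * ∫ x in a..b, f' x ^ 2 * exp (-φ x) := by
  have cf : Continuous f := continuous_iff_continuousAt.2 fun x => (hf x).continuousAt
  set Ψ : ℝ → ℝ → ℝ := fun s => forwardAverage (forwardAverage φ s) s with hΨ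
  have cA : Continuous (fun p : ℝ × ℝ => forwardAverage φ p.1 p.2) :=
    continuous_forwardAverage (G := fun _ => φ) (hφ.comp continuous_snd)
      continuous_fst continuous_snd
  have cΨ : Continuous (fun p : ℝ × ℝ => Ψ p.1 p.2) :=
    continuous_forwardAverage (X := ℝ × ℝ) (G := fun p => forwardAverage φ p.1)
      (s := Prod.fst) (t := Prod.snd)
      (by
        have : Continuous fun p : (ℝ × ℝ) × ℝ =>
            (fun p : ℝ × ℝ => forwardAverage φ p.1 p.2) (p.1.1, p.2) := by fun_prop
        exact this) continuous_fst continuous_snd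
  have hΨ0 : ∀ t, Ψ 0 t = φ t := fun t => by simp [hΨ, forwardAverage]
  have cI : ∀ g : ℝ → ℝ, Continuous g → Continuous fun s : ℝ =>
      ∫ x in a..(b - 2 * s), g x * exp (-Ψ s x) := by
    intro g hg
    apply intervalIntegral.continuous_parametric_intervalIntegral_of_continuous (μ := volume)
    · have : Continuous fun p : ℝ × ℝ => g p.2 * exp (-(fun p : ℝ × ℝ => Ψ p.1 p.2) p) := by
        fun_prop
      exact this
    · fun_prop
  have c0 : Continuous fun s : ℝ => ∫ x in a..(b - 2 * s), exp (-Ψ s x) := by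
    simpa using cI (fun _ => 1) continuous_const
  have c1 := cI f cf
  have c2 := cI (fun x => f x ^ 2) (by fun_prop)
  have c3 := cI (fun x => f' x ^ 2) (by fun_prop)
  have hev : ∀ᶠ s in nhdsWithin (0 : ℝ) (Set.Ioi 0),
      k ^ 2 * ((∫ x in a..(b - 2 * s), f x ^ 2 * exp (-Ψ s x)) *
        (∫ x in a..(b - 2 * s), exp (-Ψ s x))
        - (∫ x in a..(b - 2 * s), f x * exp (-Ψ s x)) ^ 2)
      ≤ (∫ x in a..(b - 2 * s), exp (-Ψ s x)) *
        ∫ x in a..(b - 2 * s), f' x ^ 2 * exp (-Ψ s x) := by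
    have : Set.Ioo (0 : ℝ) ((b - a) / 2) ∈ nhdsWithin (0 : ℝ) (Set.Ioi 0) :=
      Ioo_mem_nhdsGT (by linarith)
    filter_upwards [this] with s hs
    have hs0 : s ≠ 0 := hs.1.ne'
    have cAs : Continuous (forwardAverage φ s) := by
      have : Continuous fun t : ℝ =>
          (fun p : ℝ × ℝ => forwardAverage φ p.1 p.2) (s, t) := by fun_prop
      exact this
    refine intervalIntegral_variance_exp_neg (by linarith [hs.2]) hk ?_
      (fun x => hasDerivAt_forwardAverage cAs hs0 x)
      (φ'' := fun x => ((φ (x + s + s) - φ (x + s)) / s - (φ (x + s) - φ x) / s) / s)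
      (fun x => ?_) (by fun_prop) ?_ hf hf'
    · refine lt_of_le_of_lt (mul_le_mul_of_nonneg_left ?_ hk.le) hkπ
      linarith [hs.1]
    · exact (((hasDerivAt_forwardAverage hφ hs0 (x + s)).comp_add_const x s).sub
        (hasDerivAt_forwardAverage hφ hs0 x)).div_const s
    · intro x hx
      have m1 : x ∈ Set.Icc a b := ⟨hx.1, by linarith [hx.2, hs.1]⟩
      have m2 : x + s + s ∈ Set.Icc a b := ⟨by linarith [hx.1, hs.1], by linarith [hx.2]⟩
      have h := hconv.2 m1 m2 (by norm_num : (0 : ℝ) ≤ 1 / 2) (by norm_num : (0 : ℝ) ≤ 1 / 2)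
        (by norm_num)
      have e : (1 / 2 : ℝ) • x + (1 / 2 : ℝ) • (x + s + s) = x + s := by
        simp only [smul_eq_mul]; ring
      rw [e] at h
      simp only [smul_eq_mul] at h
      rw [← sub_div]
      have := hs.1
      apply div_nonneg (div_nonneg _ this.le) this.le
      linarith
  have lim := le_of_tendsto_of_tendsto
    ((continuous_const.mul ((c2.mul c0).sub (c1.pow 2))).tendsto 0 |>.mono_left nhdsWithin_le_nhds)
    ((c0.mul c3).tendsto 0 |>.mono_left nhdsWithin_le_nhds) hev
  simpa [hΨ0] using lim

/-- A bounded measurable log-concave weight whose support has diameter at most `d`. -/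
structure IsLogConcaveWeight {E : Type*} [NormedAddCommGroup E] [NormedSpace ℝ E]
    [MeasurableSpace E] (w : E → ℝ) (d : ℝ) : Prop where
  measurable : Measurable w
  nonneg : ∀ x, 0 ≤ w x
  bdd : ∃ M, ∀ x, w x ≤ M
  dist_le : ∀ x y, 0 < w x → 0 < w y → dist x y ≤ d
  rpow_mul_rpow_le : ∀ x y (a b : ℝ), 0 < a → 0 < b → a + b = 1 →
    w x ^ a * w y ^ b ≤ w (a • x + b • y)

/-- The Poincaré inequality with constant `k ^ 2`, in variance form, for `C¹` functions and all
log-concave weights on `E` with support of diameter at most `d`. -/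
def HasLogConcavePoincare (E : Type*) [NormedAddCommGroup E] [NormedSpace ℝ E]
    [MeasureSpace E] (k d : ℝ) : Prop :=
  ∀ (w : E → ℝ) (f : E → ℝ), IsLogConcaveWeight w d → ContDiff ℝ 1 f →
    k ^ 2 * ((∫ x, f x ^ 2 * w x) * (∫ x, w x) - (∫ x, f x * w x) ^ 2)
      ≤ (∫ x, w x) * ∫ x, ‖fderiv ℝ f x‖ ^ 2 * w x

namespace IsLogConcaveWeight

variable {E : Type*} [NormedAddCommGroup E] [NormedSpace ℝ E] [MeasurableSpace E] {w : E → ℝ}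
  {d : ℝ}

theorem eq_zero_of_not_pos (hw : IsLogConcaveWeight w d) {x : E} (hx : ¬ 0 < w x) : w x = 0 :=
  le_antisymm (not_lt.1 hx) (hw.nonneg x)

theorem pos_combo (hw : IsLogConcaveWeight w d) {x y : E} (hx : 0 < w x) (hy : 0 < w y)
    {a b : ℝ} (ha : 0 < a) (hb : 0 < b) (hab : a + b = 1) : 0 < w (a • x + b • y) :=
  lt_of_lt_of_le (mul_pos (rpow_pos_of_pos hx a) (rpow_pos_of_pos hy b))
    (hw.rpow_mul_rpow_le x y a b ha hb hab)

theorem convexOn_neg_log (hw : IsLogConcaveWeight w d) :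
    ConvexOn ℝ {x | 0 < w x} fun x => -log (w x) := by
  rw [convexOn_iff_forall_pos]
  refine ⟨convex_iff_forall_pos.2 fun x hx y hy a b ha hb hab =>
    hw.pos_combo hx hy ha hb hab, fun x hx y hy a b ha hb hab => ?_⟩
  have h := log_le_log (mul_pos (rpow_pos_of_pos hx a) (rpow_pos_of_pos hy b))
    (hw.rpow_mul_rpow_le x y a b ha hb hab)
  rw [log_mul (rpow_pos_of_pos hx a).ne' (rpow_pos_of_pos hy b).ne', log_rpow hx, log_rpow hy] at h
  simp only [smul_eq_mul]
  linarith

theorem exists_subset_closedBall (hw : IsLogConcaveWeight w d) :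
    ∃ x₀ R, 0 ≤ R ∧ ∀ x, 0 < w x → x ∈ Metric.closedBall x₀ R := by
  by_cases h : ∃ x₀, 0 < w x₀
  · obtain ⟨x₀, h₀⟩ := h
    exact ⟨x₀, d, dist_nonneg.trans (hw.dist_le x₀ x₀ h₀ h₀), fun x hx => hw.dist_le x x₀ hx h₀⟩
  · push Not at h
    exact ⟨0, 0, le_rfl, fun x hx => absurd hx (not_lt.2 (h x))⟩

theorem integrable_mul [BorelSpace E] [ProperSpace E] (hw : IsLogConcaveWeight w d)
    (μ : Measure E) [IsFiniteMeasureOnCompacts μ] {g : E → ℝ} (hg : Continuous g) :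
    Integrable (fun x => g x * w x) μ := by
  obtain ⟨x₀, R, -, hR⟩ := hw.exists_subset_closedBall
  obtain ⟨M, hM⟩ := hw.bdd
  have hsupp : Function.support (fun x => g x * w x) ⊆ Metric.closedBall x₀ R := by
    intro x hx
    apply hR
    by_contra h
    exact hx (by simp [hw.eq_zero_of_not_pos h])
  rw [← integrableOn_iff_integrable_of_support_subset hsupp]
  obtain ⟨C, hC⟩ := (isCompact_closedBall x₀ R).exists_bound_of_continuousOn hg.continuousOn
  refine Measure.integrableOn_of_bounded (M := C * M)
    (isCompact_closedBall x₀ R).measure_lt_top.ne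
    (hg.measurable.mul hw.measurable).aestronglyMeasurable ?_
  refine (ae_restrict_iff' Metric.isClosed_closedBall.measurableSet).2 (ae_of_all _ fun x hx => ?_)
  rw [norm_mul, Real.norm_of_nonneg (hw.nonneg x)]
  exact mul_le_mul (hC x hx) (hM x) (hw.nonneg x) ((norm_nonneg _).trans (hC x hx))

theorem integrable [BorelSpace E] [ProperSpace E] (hw : IsLogConcaveWeight w d)
    (μ : Measure E) [IsFiniteMeasureOnCompacts μ] : Integrable w μ := by
  simpa using hw.integrable_mul μ (g := fun _ => 1) continuous_const

end IsLogConcaveWeight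

theorem hasLogConcavePoincare_real {k d : ℝ} (hk : 0 < k) (hkd : k * d < π) :
    HasLogConcavePoincare ℝ k d := by
  intro w f hw hf
  set S : Set ℝ := {x | 0 < w x} with hS
  have hSconv : Convex ℝ S := hw.convexOn_neg_log.1
  by_cases hsub : S.Subsingleton
  · have h0 : w =ᵐ[volume] 0 := by
      have : volume S = 0 := hsub.countable.measure_zero _
      filter_upwards [compl_mem_ae_iff.2 this] with x hx
      exact hw.eq_zero_of_not_pos hx
    have h1 : ∀ g : ℝ → ℝ, ∫ x, g x * w x = 0 := fun g => by
      rw [integral_congr_ae (g := fun _ => 0)]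
      · simp
      · filter_upwards [h0] with x hx
        simp [hx]
    have h2 : ∫ x, w x = 0 := by simpa using h1 fun _ => 1
    rw [h1, h1, h2]
    simp
  rw [Set.not_subsingleton_iff] at hsub
  obtain ⟨p, hp, r, hr, hpr⟩ := hsub.exists_lt
  have hbd : ∀ x ∈ S, ∀ y ∈ S, x - y ≤ d := fun x hx y hy =>
    (le_abs_self _).trans (hw.dist_le x y hx hy)
  have hne : S.Nonempty := ⟨p, hp⟩
  have hA : BddAbove S := ⟨p + d, fun x hx => by linarith [hbd x hx p hp]⟩
  have hB : BddBelow S := ⟨p - d, fun x hx => by linarith [hbd p hp x hx]⟩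
  set a := sInf S
  set b := sSup S
  have hab : a < b := (csInf_le hB hp).trans_lt (hpr.trans_le (le_csSup hA hr))
  have hbad : b - a ≤ d := by
    have : b ≤ a + d := csSup_le hne fun x hx => by
      have : x - d ≤ a := le_csInf hne fun y hy => by linarith [hbd x hx y hy]
      linarith
    linarith
  have hIoo : Set.Ioo a b ⊆ S := by
    intro x hx
    obtain ⟨y, hy, hyx⟩ := exists_lt_of_csInf_lt hne hx.1
    obtain ⟨z, hz, hxz⟩ := exists_lt_of_lt_csSup hne hx.2
    exact hSconv.ordConnected.out hy hz ⟨hyx.le, hxz.le⟩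
  have hcont : ContinuousOn (fun x => -log (w x)) (Set.Ioo a b) :=
    (hw.convexOn_neg_log.subset hIoo (convex_Ioo a b)).continuousOn isOpen_Ioo
  have hfd : ∀ x, HasDerivAt f (deriv f x) x := fun x =>
    (hf.differentiable (by norm_num) x).hasDerivAt
  have cf : Continuous f := hf.continuous
  have cf' : Continuous (deriv f) := hf.continuous_deriv (by norm_num)
  have hfull : ∀ g : ℝ → ℝ, ∫ x, g x * w x = ∫ x in a..b, g x * w x := by
    intro g
    rw [intervalIntegral.integral_of_le hab.le, ← integral_Icc_eq_integral_Ioc,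
      setIntegral_eq_integral_of_forall_compl_eq_zero]
    intro x hx
    have : ¬ 0 < w x := fun h => hx ⟨csInf_le hB h, le_csSup hA h⟩
    simp [hw.eq_zero_of_not_pos this]
  have hprim : ∀ g : ℝ → ℝ, Continuous g →
      Continuous fun s : ℝ => ∫ x in (a + s)..(b - s), g x * w x := by
    intro g hg
    have hi := hw.integrable_mul volume hg
    have h1 : Continuous fun u => ∫ x in a..u, g x * w x :=
      intervalIntegral.continuous_primitive (fun _ _ => hi.intervalIntegrable) a
    have h2 : (fun s : ℝ => ∫ x in (a + s)..(b - s), g x * w x) =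
        fun s => (∫ x in a..(b - s), g x * w x) - ∫ x in a..(a + s), g x * w x := by
      ext s
      rw [intervalIntegral.integral_interval_sub_left hi.intervalIntegrable hi.intervalIntegrable]
    rw [h2]
    exact (h1.comp (by fun_prop : Continuous fun s : ℝ => b - s)).sub
      (h1.comp (by fun_prop : Continuous fun s : ℝ => a + s))
  have hinner : ∀ᶠ s in nhdsWithin (0 : ℝ) (Set.Ioi 0),
      k ^ 2 * ((∫ x in (a + s)..(b - s), f x ^ 2 * w x) * (∫ x in (a + s)..(b - s), 1 * w x)
        - (∫ x in (a + s)..(b - s), f x * w x) ^ 2)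
      ≤ (∫ x in (a + s)..(b - s), 1 * w x) * ∫ x in (a + s)..(b - s), deriv f x ^ 2 * w x := by
    have : Set.Ioo (0 : ℝ) ((b - a) / 2) ∈ nhdsWithin (0 : ℝ) (Set.Ioi 0) :=
      Ioo_mem_nhdsGT (by linarith)
    filter_upwards [this] with s hs
    have hlt : a + s < b - s := by linarith [hs.2]
    have hsubs : Set.Icc (a + s) (b - s) ⊆ Set.Ioo a b := fun x hx =>
      ⟨by linarith [hx.1, hs.1], by linarith [hx.2, hs.1]⟩
    have hφ : Continuous (Set.IccExtend hlt.le
        ((Set.Icc (a + s) (b - s)).domRestrict fun x => -log (w x))) :=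
      (continuousOn_iff_continuous_domRestrict.1 (hcont.mono hsubs)).Icc_extend'
    set φ := Set.IccExtend hlt.le ((Set.Icc (a + s) (b - s)).domRestrict fun x => -log (w x))
    have hφe : ∀ x ∈ Set.Icc (a + s) (b - s), φ x = -log (w x) := fun x hx => by
      simp only [φ]
      rw [Set.IccExtend_of_mem _ _ hx]
      rfl
    have hconv : ConvexOn ℝ (Set.Icc (a + s) (b - s)) φ :=
      (hw.convexOn_neg_log.subset (hsubs.trans hIoo) (convex_Icc _ _)).congr
        fun x hx => (hφe x hx).symm
    have := intervalIntegral_variance_exp_neg_of_convexOn hlt hk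
      (lt_of_le_of_lt (mul_le_mul_of_nonneg_left (by linarith [hs.1]) hk.le) hkd) hφ hconv hfd cf'
    have he : ∀ g : ℝ → ℝ, ∫ x in (a + s)..(b - s), g x * w x =
        ∫ x in (a + s)..(b - s), g x * exp (-φ x) := fun g => by
      apply intervalIntegral.integral_congr
      intro x hx
      rw [Set.uIcc_of_le hlt.le] at hx
      simp only
      rw [hφe x hx, neg_neg, exp_log (hIoo (hsubs hx))]
    rw [he, he, he, he]
    simpa using this
  have lim := le_of_tendsto_of_tendsto
    ((continuous_const.mul (((hprim _ (cf.pow 2)).mul (hprim (fun _ => 1) continuous_const)).sub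
      ((hprim f cf).pow 2))).tendsto 0 |>.mono_left nhdsWithin_le_nhds)
    (((hprim (fun _ => 1) continuous_const).mul (hprim _ (cf'.pow 2))).tendsto 0
      |>.mono_left nhdsWithin_le_nhds) hinner
  have e0 : ∫ x, w x = ∫ x in a..b, 1 * w x := by rw [← hfull fun _ => 1]; simp
  have e1 : ∀ x, ‖fderiv ℝ f x‖ ^ 2 = deriv f x ^ 2 := fun x => by
    rw [← norm_deriv_eq_norm_fderiv, Real.norm_eq_abs, sq_abs]
  simp only [add_zero, sub_zero, Pi.pow_apply, Pi.mul_apply, Pi.sub_apply] at lim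
  simp_rw [e1]
  rw [e0, hfull, hfull, hfull fun x => deriv f x ^ 2]
  exact lim

/-- One-dimensional Brunn–Minkowski inequality, the sum set being contained in an interval. -/
theorem Real.brunn_minkowski_of_convex {A B C : Set ℝ} {a b : ℝ} (ha : 0 < a) (hb : 0 < b)
    (hA : A.Nonempty) (hB : B.Nonempty) (bC : Bornology.IsBounded C)
    (bA : Bornology.IsBounded A) (bB : Bornology.IsBounded B)
    (hC : Convex ℝ C) (h : ∀ x ∈ A, ∀ y ∈ B, a * x + b * y ∈ C) :
    ENNReal.ofReal a * volume A + ENNReal.ofReal b * volume B ≤ volume C := by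
  have vol_le : ∀ D : Set ℝ, Bornology.IsBounded D → volume D ≤ ENNReal.ofReal (sSup D - sInf D) :=
    fun D hD => by
      rw [← Real.volume_Icc]
      exact measure_mono fun x hx => ⟨csInf_le hD.bddBelow hx, le_csSup hD.bddAbove hx⟩
  have hCne : C.Nonempty := by
    obtain ⟨x, hx⟩ := hA
    obtain ⟨y, hy⟩ := hB
    exact ⟨_, h x hx y hy⟩
  have hIoo : Set.Ioo (sInf C) (sSup C) ⊆ C := by
    intro x hx
    obtain ⟨y, hy, hyx⟩ := exists_lt_of_csInf_lt hCne hx.1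
    obtain ⟨z, hz, hxz⟩ := exists_lt_of_lt_csSup hCne hx.2
    exact hC.ordConnected.out hy hz ⟨hyx.le, hxz.le⟩
  have hsup : a * sSup A + b * sSup B ≤ sSup C := by
    have h1 : ∀ y ∈ B, sSup A ≤ (sSup C - b * y) / a := fun y hy =>
      csSup_le hA fun x hx => by
        rw [le_div_iff₀ ha]
        linarith [le_csSup bC.bddAbove (h x hx y hy)]
    have h2 : sSup B ≤ (sSup C - a * sSup A) / b := csSup_le hB fun y hy => by
      have := h1 y hy
      rw [le_div_iff₀ ha] at this
      rw [le_div_iff₀ hb]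
      linarith
    rw [le_div_iff₀ hb] at h2
    linarith
  have hinf : sInf C ≤ a * sInf A + b * sInf B := by
    have h1 : ∀ y ∈ B, (sInf C - b * y) / a ≤ sInf A := fun y hy =>
      le_csInf hA fun x hx => by
        rw [div_le_iff₀ ha]
        linarith [csInf_le bC.bddBelow (h x hx y hy)]
    have h2 : (sInf C - a * sInf A) / b ≤ sInf B := le_csInf hB fun y hy => by
      have := h1 y hy
      rw [div_le_iff₀ ha] at this
      rw [div_le_iff₀ hb]
      linarith
    rw [div_le_iff₀ hb] at h2
    linarith
  have nn : ∀ D : Set ℝ, Bornology.IsBounded D → D.Nonempty → 0 ≤ sSup D - sInf D :=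
    fun D hD hne => sub_nonneg.2 (csInf_le_csSup hne hD.bddBelow hD.bddAbove)
  calc ENNReal.ofReal a * volume A + ENNReal.ofReal b * volume B
      ≤ ENNReal.ofReal a * ENNReal.ofReal (sSup A - sInf A)
        + ENNReal.ofReal b * ENNReal.ofReal (sSup B - sInf B) := by
        gcongr
        · exact vol_le A bA
        · exact vol_le B bB
    _ = ENNReal.ofReal (a * (sSup A - sInf A) + b * (sSup B - sInf B)) := by
        rw [← ENNReal.ofReal_mul ha.le, ← ENNReal.ofReal_mul hb.le, ← ENNReal.ofReal_add
          (mul_nonneg ha.le (nn A bA hA)) (mul_nonneg hb.le (nn B bB hB))]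
    _ ≤ ENNReal.ofReal (sSup C - sInf C) := ENNReal.ofReal_le_ofReal (by linarith)
    _ = volume (Set.Ioo (sInf C) (sSup C)) := Real.volume_Ioo.symm
    _ ≤ volume C := measure_mono hIoo

namespace IsLogConcaveWeight

theorem convex_superlevel {E : Type*} [NormedAddCommGroup E] [NormedSpace ℝ E] [MeasurableSpace E]
    {w : E → ℝ} {d : ℝ} (hw : IsLogConcaveWeight w d) {s : ℝ} (hs : 0 < s) :
    Convex ℝ {x | s < w x} := by
  rw [convex_iff_forall_pos]
  intro x hx y hy a b ha hb hab
  refine lt_of_lt_of_le ?_ (hw.rpow_mul_rpow_le x y a b ha hb hab)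
  calc s = s ^ a * s ^ b := by rw [← rpow_add hs, hab, rpow_one]
    _ < w x ^ a * w y ^ b := mul_lt_mul'' (rpow_lt_rpow hs.le hx ha) (rpow_lt_rpow hs.le hy hb)
        (by positivity) (by positivity)

theorem isBounded_superlevel {E : Type*} [NormedAddCommGroup E] [NormedSpace ℝ E]
    [MeasurableSpace E] {w : E → ℝ} {d : ℝ} (hw : IsLogConcaveWeight w d) {s : ℝ} (hs : 0 < s) :
    Bornology.IsBounded {x | s < w x} := by
  obtain ⟨x₀, R, -, hR⟩ := hw.exists_subset_closedBall
  exact Metric.isBounded_closedBall.subset fun x hx => hR x (hs.trans hx)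

end IsLogConcaveWeight

/-- One-dimensional Prékopa–Leindler inequality for log-concave weights. -/
theorem prekopa_leindler_real {u v z : ℝ → ℝ} {d₁ d₂ d₃ : ℝ} (hu : IsLogConcaveWeight u d₁)
    (hv : IsLogConcaveWeight v d₂) (hz : IsLogConcaveWeight z d₃) {a b : ℝ} (ha : 0 < a)
    (hb : 0 < b) (hab : a + b = 1) (h : ∀ s t, u s ^ a * v t ^ b ≤ z (a * s + b * t)) :
    (∫ x, u x) ^ a * (∫ x, v x) ^ b ≤ ∫ x, z x := by
  have hz0 : 0 ≤ ∫ x, z x := integral_nonneg hz.nonneg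
  by_cases hu0 : ∃ x, 0 < u x
  swap
  · push Not at hu0
    have : u = fun _ => 0 := funext fun x => le_antisymm (hu0 x) (hu.nonneg x)
    simpa [this, zero_rpow ha.ne'] using hz0
  by_cases hv0 : ∃ x, 0 < v x
  swap
  · push Not at hv0
    have : v = fun _ => 0 := funext fun x => le_antisymm (hv0 x) (hv.nonneg x)
    simpa [this, zero_rpow hb.ne'] using hz0
  have sup : ∀ (g : ℝ → ℝ), (∃ M, ∀ x, g x ≤ M) → (∃ x, 0 < g x) →
      ∃ M, 0 < M ∧ (∀ x, g x ≤ M) ∧ ∀ t < 1, ∃ x, t * M < g x := by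
    rintro g ⟨M, hM⟩ ⟨x₀, hx₀⟩
    have hb : BddAbove (Set.range g) := ⟨M, by rintro _ ⟨x, rfl⟩; exact hM x⟩
    have hpos : 0 < sSup (Set.range g) := hx₀.trans_le (le_csSup hb ⟨x₀, rfl⟩)
    refine ⟨sSup (Set.range g), hpos, fun x => le_csSup hb ⟨x, rfl⟩, fun t ht => ?_⟩
    obtain ⟨_, ⟨x, rfl⟩, hx⟩ := exists_lt_of_lt_csSup (Set.range_nonempty g)
      (show t * sSup (Set.range g) < sSup (Set.range g) by nlinarith)
    exact ⟨x, hx⟩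
  obtain ⟨U, hU, huU, hUs⟩ := sup u hu.bdd hu0
  obtain ⟨V, hV, hvV, hVs⟩ := sup v hv.bdd hv0
  set Z := U ^ a * V ^ b with hZdef
  have hZ : 0 < Z := mul_pos (rpow_pos_of_pos hU a) (rpow_pos_of_pos hV b)
  have cake : ∀ (g : ℝ → ℝ) (d G : ℝ), IsLogConcaveWeight g d → 0 < G →
      ENNReal.ofReal ((∫ x, g x) / G) = ∫⁻ t in Set.Ioi 0, volume {x | t * G < g x} := by
    intro g d G hg hG
    rw [← integral_div, ofReal_integral_eq_lintegral_ofReal ((hg.integrable _).div_const _)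
      (ae_of_all _ fun x => div_nonneg (hg.nonneg x) hG.le),
      lintegral_eq_lintegral_meas_lt _ (ae_of_all _ fun x => div_nonneg (hg.nonneg x) hG.le)
      (hg.measurable.div_const _).aemeasurable]
    simp_rw [lt_div_iff₀ hG]
  have key : ENNReal.ofReal a * ENNReal.ofReal ((∫ x, u x) / U)
      + ENNReal.ofReal b * ENNReal.ofReal ((∫ x, v x) / V) ≤ ENNReal.ofReal ((∫ x, z x) / Z) := by
    rw [cake u _ U hu hU, cake v _ V hv hV, cake z _ Z hz hZ]
    have meas : ∀ (g : ℝ → ℝ) (G : ℝ), 0 < G → Measurable fun t : ℝ => volume {x | t * G < g x} :=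
      fun g G hG => Antitone.measurable fun s t hst => measure_mono fun x hx =>
        lt_of_le_of_lt (mul_le_mul_of_nonneg_right hst hG.le) hx
    rw [← lintegral_const_mul _ (meas u U hU), ← lintegral_const_mul _ (meas v V hV),
      ← lintegral_add_left ((meas u U hU).const_mul _)]
    refine setLIntegral_mono (meas z Z hZ) fun t (ht : 0 < t) => ?_
    by_cases ht1 : t < 1
    · refine Real.brunn_minkowski_of_convex ha hb (hUs t ht1) (hVs t ht1)
        (hz.isBounded_superlevel (mul_pos ht hZ)) (hu.isBounded_superlevel (mul_pos ht hU))
        (hv.isBounded_superlevel (mul_pos ht hV)) (hz.convex_superlevel (mul_pos ht hZ)) ?_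
      intro x hx y hy
      refine lt_of_lt_of_le ?_ (h x y)
      calc t * Z = (t * U) ^ a * (t * V) ^ b := by
            rw [mul_rpow ht.le hU.le, mul_rpow ht.le hV.le, hZdef]
            conv_lhs => rw [← rpow_one t, ← hab, rpow_add ht]
            ring
        _ < u x ^ a * v y ^ b := mul_lt_mul'' (rpow_lt_rpow (mul_pos ht hU).le hx ha)
            (rpow_lt_rpow (mul_pos ht hV).le hy hb) (by positivity) (by positivity)
    · have e : ∀ (g : ℝ → ℝ) (G : ℝ), 0 < G → (∀ x, g x ≤ G) → {x | t * G < g x} = ∅ := by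
        intro g G hG hgG
        ext x
        simp only [Set.mem_ofPred_eq, Set.mem_empty_iff_false, iff_false, not_lt]
        exact (hgG x).trans (by nlinarith)
      rw [e u U hU huU, e v V hV hvV]
      simp
  have iu : 0 ≤ ∫ x, u x := integral_nonneg hu.nonneg
  have iv : 0 ≤ ∫ x, v x := integral_nonneg hv.nonneg
  rw [← ENNReal.ofReal_mul ha.le, ← ENNReal.ofReal_mul hb.le, ← ENNReal.ofReal_add
    (by positivity) (by positivity), ENNReal.ofReal_le_ofReal_iff (by positivity)] at key
  have amgm := (geom_mean_le_arith_mean2_weighted ha.le hb.le (div_nonneg iu hU.le)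
    (div_nonneg iv hV.le) hab).trans key
  rw [div_rpow iu hU.le, div_rpow iv hV.le, div_mul_div_comm, ← hZdef,
    div_le_div_iff_of_pos_right hZ] at amgm
  exact amgm

namespace IsLogConcaveWeight

section Marginal

theorem fiber {F : Type*} [NormedAddCommGroup F] [NormedSpace ℝ F] [MeasurableSpace F]
    {W : F × ℝ → ℝ} {d : ℝ} (hW : IsLogConcaveWeight W d) (y : F) :
    IsLogConcaveWeight (fun t => W (y, t)) d where
  measurable := hW.measurable.comp (measurable_const.prodMk measurable_id)
  nonneg _ := hW.nonneg _
  bdd := hW.bdd.imp fun _ hM _ => hM _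
  dist_le s t hs ht := le_trans (by simp [Prod.dist_eq]) (hW.dist_le _ _ hs ht)
  rpow_mul_rpow_le s t a b ha hb hab := by
    have h := hW.rpow_mul_rpow_le (y, s) (y, t) a b ha hb hab
    rwa [Prod.smul_mk, Prod.smul_mk, Prod.mk_add_mk, ← add_smul, hab, one_smul] at h

theorem marginal {F : Type*} [NormedAddCommGroup F] [NormedSpace ℝ F] [MeasurableSpace F]
    {W : F × ℝ → ℝ} {d : ℝ} (hW : IsLogConcaveWeight W d) :
    IsLogConcaveWeight (fun y => ∫ t, W (y, t)) d where
  measurable := (StronglyMeasurable.integral_prod_right (f := fun y t => W (y, t)) (ν := volume)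
    hW.measurable.stronglyMeasurable).measurable
  nonneg y := integral_nonneg fun t => hW.nonneg _
  bdd := by
    obtain ⟨M, hM⟩ := hW.bdd
    obtain ⟨x₀, R, hR0, hR⟩ := hW.exists_subset_closedBall
    refine ⟨∫ t, (Metric.closedBall x₀.2 R).indicator (fun _ => M) t, fun y => ?_⟩
    refine integral_mono ((hW.fiber y).integrable _) ?_ fun t => ?_
    · exact (integrable_indicator_iff Metric.isClosed_closedBall.measurableSet).2
        (integrableOn_const (isCompact_closedBall _ _).measure_lt_top.ne)
    · by_cases ht : 0 < W (y, t)
      · have : t ∈ Metric.closedBall x₀.2 R := (le_max_right (dist y x₀.1) _).trans (hR _ ht)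
        simpa [Set.indicator_of_mem this] using hM (y, t)
      · simp only [hW.eq_zero_of_not_pos ht]
        exact Set.indicator_nonneg (fun _ _ => (hW.nonneg (y, t)).trans (hM _)) t
  dist_le x y hx hy := by
    have ex : ∀ x : F, 0 < ∫ t, W (x, t) → ∃ t, 0 < W (x, t) := fun x hx => by
      by_contra! h
      exact absurd hx (not_lt.2 (integral_nonpos h))
    obtain ⟨s, hs⟩ := ex x hx
    obtain ⟨t, ht⟩ := ex y hy
    exact le_trans (le_max_left _ _) (hW.dist_le _ _ hs ht)
  rpow_mul_rpow_le x y a b ha hb hab :=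
    prekopa_leindler_real (hW.fiber x) (hW.fiber y) (hW.fiber _) ha hb hab fun s t =>
      hW.rpow_mul_rpow_le (x, s) (y, t) a b ha hb hab

variable {F : Type*} [NormedAddCommGroup F] [InnerProductSpace ℝ F] [FiniteDimensional ℝ F]
  [MeasurableSpace F] [BorelSpace F] {W : F × ℝ → ℝ} {d : ℝ}

theorem integral_marginal (hW : IsLogConcaveWeight W d) {g : F → ℝ} (hg : Continuous g) :
    ∫ y, g y * ∫ t, W (y, t) = ∫ p, g p.1 * W p := by
  have h := hW.integrable_mul volume (hg.comp continuous_fst)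
  rw [Measure.volume_eq_prod] at h ⊢
  simp only [Function.comp_apply] at h
  rw [integral_prod _ h]
  simp_rw [integral_const_mul]

theorem variance_le_of_marginal (hW : IsLogConcaveWeight W d) {k : ℝ}
    (hF : HasLogConcavePoincare F k d) {g : F → ℝ} (hg : ContDiff ℝ 1 g) :
    k ^ 2 * ((∫ p, g p.1 ^ 2 * W p) * (∫ p, W p) - (∫ p, g p.1 * W p) ^ 2)
      ≤ (∫ p, W p) * ∫ p, ‖fderiv ℝ g p.1‖ ^ 2 * W p := by
  have cg := hg.continuous
  have cg' := hg.continuous_fderiv (by norm_num)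
  have h1 : ∫ y, ∫ t, W (y, t) = ∫ p, W p := by
    simpa using hW.integral_marginal (g := fun _ => 1) continuous_const
  have h := hF _ g hW.marginal hg
  rwa [h1, hW.integral_marginal (g := fun y => g y ^ 2) (cg.pow 2),
    hW.integral_marginal cg,
    hW.integral_marginal (g := fun y => ‖fderiv ℝ g y‖ ^ 2) (by fun_prop)] at h

end Marginal

section Strip

theorem comp_linear {E F : Type*} [NormedAddCommGroup E] [NormedSpace ℝ E] [MeasurableSpace E]
    [NormedAddCommGroup F] [NormedSpace ℝ F] [MeasurableSpace F] {w : E → ℝ} {d : ℝ}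
    (hw : IsLogConcaveWeight w d) (A : F →ₗ[ℝ] E) (hA : Measurable A)
    (hdist : ∀ p q, dist p q ≤ dist (A p) (A q)) : IsLogConcaveWeight (fun p => w (A p)) d where
  measurable := hw.measurable.comp hA
  nonneg _ := hw.nonneg _
  bdd := hw.bdd.imp fun _ hM _ => hM _
  dist_le p q hp hq := (hdist p q).trans (hw.dist_le _ _ hp hq)
  rpow_mul_rpow_le x y a b ha hb hab := by
    simpa using hw.rpow_mul_rpow_le (A x) (A y) a b ha hb hab

variable {E F : Type*} [NormedAddCommGroup E] [InnerProductSpace ℝ E] [FiniteDimensional ℝ E]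
  [MeasurableSpace E] [BorelSpace E] [NormedAddCommGroup F] [InnerProductSpace ℝ F]
  [FiniteDimensional ℝ F] [MeasurableSpace F] [BorelSpace F] {w : E → ℝ} {d : ℝ}

/-- Approximate Poincaré inequality for a weight concentrated near the hyperplane
`range A + t₀ • N`, given the inequality in one dimension less. -/
theorem poincare_of_thin {k : ℝ} (hF : HasLogConcavePoincare F k d)
    (hw : IsLogConcaveWeight w d) {A : F →ₗᵢ[ℝ] E} {N : E} (hN : ‖N‖ = 1)
    (hNA : ∀ y, ⟪A y, N⟫ = 0)
    (hmp : MeasurePreserving (fun p : F × ℝ => A p.1 + p.2 • N) volume volume)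
    {f : E → ℝ} (hf : ContDiff ℝ 1 f) (hmean : ∫ x, f x * w x = 0) {t₀ η : ℝ}
    (h0 : ∀ x, 0 < w x → |f (x + (t₀ - ⟪x, N⟫) • N) - f x| ≤ η)
    (h1 : ∀ x, 0 < w x → |f (x + (t₀ - ⟪x, N⟫) • N) ^ 2 - f x ^ 2| ≤ η)
    (h2 : ∀ x, 0 < w x → ‖fderiv ℝ f (x + (t₀ - ⟪x, N⟫) • N)‖ ^ 2 ≤ ‖fderiv ℝ f x‖ ^ 2 + η) :
    k ^ 2 * ∫ x, f x ^ 2 * w x ≤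
      (∫ x, ‖fderiv ℝ f x‖ ^ 2 * w x) + (η + k ^ 2 * (η + η ^ 2)) * ∫ x, w x := by
  set L : F × ℝ →ₗ[ℝ] E := A.toLinearMap.coprod (LinearMap.toSpanSingleton ℝ E N) with hL
  have hLa : ∀ p, L p = A p.1 + p.2 • N := fun p => by simp [hL]
  have hLeq : (fun p : F × ℝ => A p.1 + p.2 • N) = L := funext fun p => (hLa p).symm
  rw [hLeq] at hmp
  have cL : Continuous L := L.continuous_of_finiteDimensional
  have hin : ∀ p, ⟪L p, N⟫ = p.2 := fun p => by
    rw [hLa, inner_add_left, hNA, inner_smul_left, real_inner_self_eq_norm_sq, hN]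
    simp
  have hnorm : ∀ p, ‖p‖ ≤ ‖L p‖ := fun p => by
    have e : ‖L p‖ ^ 2 = ‖p.1‖ ^ 2 + p.2 ^ 2 := by
      rw [hLa, norm_add_sq_real, inner_smul_right, hNA, A.norm_map, norm_smul, hN]
      simp
    rw [Prod.norm_def]
    apply max_le
    · exact abs_le_of_sq_le_sq' (by nlinarith [sq_nonneg p.2]) (norm_nonneg _) |>.2
    · rw [Real.norm_eq_abs]
      exact abs_le_of_sq_le_sq (by nlinarith [sq_nonneg ‖p.1‖]) (norm_nonneg _)
  have hW := hw.comp_linear L cL.measurable fun p q => by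
    rw [dist_eq_norm, dist_eq_norm, ← map_sub]
    exact hnorm _
  set W : F × ℝ → ℝ := fun p => w (L p) with hWdef
  set fb : F → ℝ := fun y => f (A y + t₀ • N) with hfb
  have hfbC : ContDiff ℝ 1 fb :=
    hf.comp ((A.toContinuousLinearMap.contDiff).add contDiff_const)
  have cf := hf.continuous
  have cf' := hf.continuous_fderiv (by norm_num)
  have cfb := hfbC.continuous
  have cfb' := hfbC.continuous_fderiv (by norm_num)
  have hfd : ∀ y, ‖fderiv ℝ fb y‖ ≤ ‖fderiv ℝ f (A y + t₀ • N)‖ := fun y => by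
    have hd : HasFDerivAt fb ((fderiv ℝ f (A y + t₀ • N)).comp A.toContinuousLinearMap) y :=
      HasFDerivAt.comp y (hf.differentiable (by norm_num) _).hasFDerivAt
        ((A.toContinuousLinearMap.hasFDerivAt).add_const _)
    rw [hd.fderiv]
    refine (ContinuousLinearMap.opNorm_comp_le _ _).trans ?_
    exact mul_le_of_le_one_right (norm_nonneg _) A.norm_toContinuousLinearMap_le
  have hshift : ∀ p : F × ℝ, L p + (t₀ - ⟪L p, N⟫) • N = A p.1 + t₀ • N := fun p => by
    rw [hin, hLa, sub_smul]
    abel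
  have tr : ∀ g : E → ℝ, Continuous g → ∫ x, g x * w x = ∫ p, g (L p) * W p := fun g hg => by
    have h := integral_map (f := fun x => g x * w x) (μ := volume) hmp.measurable.aemeasurable
      (hg.measurable.mul hw.measurable).aestronglyMeasurable
    rwa [hmp.map_eq] at h
  have trw : ∫ x, w x = ∫ p, W p := by simpa using tr (fun _ => 1) continuous_const
  have ifb := hW.integrable_mul volume (cfb.comp continuous_fst)
  have ifb2 := hW.integrable_mul volume ((cfb.pow 2).comp continuous_fst)
  have if1 := hW.integrable_mul volume (cf.comp cL)
  have if2 := hW.integrable_mul volume ((cf.pow 2).comp cL)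
  have ig : Integrable (fun p => ‖fderiv ℝ f (L p)‖ ^ 2 * W p) volume :=
    hW.integrable_mul volume (g := fun p => ‖fderiv ℝ f (L p)‖ ^ 2) (by fun_prop)
  have igb : Integrable (fun p : F × ℝ => ‖fderiv ℝ fb p.1‖ ^ 2 * W p) volume :=
    hW.integrable_mul volume (g := fun p => ‖fderiv ℝ fb p.1‖ ^ 2) (by fun_prop)
  have iW := hW.integrable volume
  simp only [Function.comp_apply, Pi.pow_apply] at ifb ifb2 if1 if2
  have hvar := hW.variance_le_of_marginal hF hfbC
  rw [tr _ cf] at hmean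
  rw [tr (fun x => f x ^ 2) (cf.pow 2), tr (fun x => ‖fderiv ℝ f x‖ ^ 2) (by fun_prop), trw]
  have key : ∀ {P Q : F × ℝ → ℝ}, (∀ p, 0 < W p → P p ≤ Q p) →
      ∀ p, P p * W p ≤ Q p * W p := fun hPQ p => by
    by_cases hp : 0 < W p
    · exact mul_le_mul_of_nonneg_right (hPQ p hp) hp.le
    · simp [hW.eq_zero_of_not_pos hp]
  have b1 : |∫ p, fb p.1 * W p| ≤ η * ∫ p, W p := by
    have e : ∫ p, fb p.1 * W p = ∫ p, (fb p.1 * W p - f (L p) * W p) := by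
      rw [integral_sub ifb if1, hmean, sub_zero]
    rw [e, ← integral_const_mul]
    refine (abs_integral_le_integral_abs).trans (integral_mono (ifb.sub if1).abs
      (iW.const_mul η) fun p => ?_)
    simp only
    rw [← sub_mul, abs_mul, abs_of_nonneg (hW.nonneg p)]
    refine key (P := fun p => |fb p.1 - f (L p)|) (Q := fun _ => η) (fun p hp => ?_) p
    have := h0 (L p) hp
    rwa [hshift] at this
  have b2 : ∫ p, f (L p) ^ 2 * W p ≤ (∫ p, fb p.1 ^ 2 * W p) + η * ∫ p, W p := by
    rw [← integral_const_mul, ← integral_add ifb2 (iW.const_mul η)]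
    refine integral_mono if2 (ifb2.add (iW.const_mul η)) fun p => ?_
    simp only
    rw [← add_mul]
    refine key (P := fun p => f (L p) ^ 2) (Q := fun p => fb p.1 ^ 2 + η) (fun p hp => ?_) p
    have := h1 (L p) hp
    rw [hshift] at this
    simp only [hfb]
    linarith [(abs_le.1 this).1]
  have b3 : ∫ p, ‖fderiv ℝ fb p.1‖ ^ 2 * W p ≤
      (∫ p, ‖fderiv ℝ f (L p)‖ ^ 2 * W p) + η * ∫ p, W p := by
    rw [← integral_const_mul, ← integral_add ig (iW.const_mul η)]
    refine integral_mono igb (ig.add (iW.const_mul η)) fun p => ?_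
    simp only
    rw [← add_mul]
    refine key (P := fun p => ‖fderiv ℝ fb p.1‖ ^ 2)
      (Q := fun p => ‖fderiv ℝ f (L p)‖ ^ 2 + η) (fun p hp => ?_) p
    have := h2 (L p) hp
    rw [hshift] at this
    exact (pow_le_pow_left₀ (norm_nonneg _) (hfd _) 2).trans this
  set m := ∫ p, W p
  have hm : 0 ≤ m := integral_nonneg hW.nonneg
  rcases hm.eq_or_lt with hm0 | hm0
  · have z : ∀ G : F × ℝ → ℝ, ∫ p, G p * W p = 0 := fun G => by
      have := (integral_eq_zero_iff_of_nonneg hW.nonneg iW).1 hm0.symm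
      rw [integral_congr_ae (g := fun _ => 0), integral_zero]
      filter_upwards [this] with p hp
      simp only [hp, Pi.zero_apply, mul_zero]
    rw [z, z, ← hm0]
    simp
  · have hsq : (∫ p, fb p.1 * W p) ^ 2 ≤ (η * m) ^ 2 := sq_le_sq' (abs_le.1 b1).1 (abs_le.1 b1).2
    refine le_of_mul_le_mul_left ?_ hm0
    have k2 := sq_nonneg k
    nlinarith [mul_le_mul_of_nonneg_left b2 (mul_nonneg k2 hm), mul_le_mul_of_nonneg_left b3 hm,
      mul_le_mul_of_nonneg_left hsq k2]

end Strip

end IsLogConcaveWeight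

theorem EuclideanSpace.exists_measurePreserving_prod {n : ℕ} {N : EuclideanSpace ℝ (Fin (n + 1))}
    (hN : ‖N‖ = 1) :
    ∃ A : EuclideanSpace ℝ (Fin n) →ₗᵢ[ℝ] EuclideanSpace ℝ (Fin (n + 1)),
      (∀ y, ⟪A y, N⟫ = 0) ∧
      MeasurePreserving (fun p : EuclideanSpace ℝ (Fin n) × ℝ => A p.1 + p.2 • N)
        volume volume := by
  have : Fact (Module.finrank ℝ (EuclideanSpace ℝ (Fin (n + 1))) = n + 1) := ⟨by simp⟩
  have hN0 : N ≠ 0 := by rintro rfl; simp at hN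
  let b := OrthonormalBasis.fromOrthogonalSpanSingleton (𝕜 := ℝ) n hN0
  let A : EuclideanSpace ℝ (Fin n) →ₗᵢ[ℝ] EuclideanSpace ℝ (Fin (n + 1)) :=
    (Submodule.subtypeₗᵢ _).comp b.repr.symm.toLinearIsometry
  have hA : ∀ y, ⟪A y, N⟫ = 0 := fun y =>
    Submodule.mem_orthogonal_singleton_iff_inner_left.1 (b.repr.symm y).2
  refine ⟨A, hA, ?_⟩
  let L₀ : WithLp 2 (EuclideanSpace ℝ (Fin n) × ℝ) →ₗ[ℝ] EuclideanSpace ℝ (Fin (n + 1)) :=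
    { toFun := fun p => A p.fst + p.snd • N
      map_add' := fun p q => by simp [add_smul]; abel
      map_smul' := fun c p => by simp [mul_smul] }
  let L : WithLp 2 (EuclideanSpace ℝ (Fin n) × ℝ) →ₗᵢ[ℝ] EuclideanSpace ℝ (Fin (n + 1)) :=
    { L₀ with
      norm_map' := fun p => by
        change ‖A p.fst + p.snd • N‖ = ‖p‖
        rw [← sq_eq_sq₀ (norm_nonneg _) (norm_nonneg _), WithLp.prod_norm_sq_eq_of_L2,
          norm_add_sq_real, inner_smul_right, hA, A.norm_map, norm_smul, hN]
        simp }
  let e := L.toLinearIsometryEquiv (by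
    rw [(WithLp.linearEquiv 2 ℝ (EuclideanSpace ℝ (Fin n) × ℝ)).finrank_eq]; simp)
  exact e.measurePreserving.comp (WithLp.volume_preserving_toLp _ _)

theorem HasLogConcavePoincare.of_linearIsometryEquiv {E F : Type*} [NormedAddCommGroup E]
    [InnerProductSpace ℝ E] [FiniteDimensional ℝ E] [MeasurableSpace E] [BorelSpace E]
    [NormedAddCommGroup F] [InnerProductSpace ℝ F] [FiniteDimensional ℝ F] [MeasurableSpace F]
    [BorelSpace F] {k d : ℝ} (h : HasLogConcavePoincare E k d) (e : E ≃ₗᵢ[ℝ] F) :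
    HasLogConcavePoincare F k d := by
  intro w f hw hf
  have key := h (fun p => w (e p)) (fun p => f (e p))
    (hw.comp_linear e.toLinearEquiv.toLinearMap e.continuous.measurable
      fun p q => (e.dist_map p q).ge)
    (hf.comp e.contDiff)
  have hInt : ∀ g : F → ℝ, ∫ p, g (e p) = ∫ x, g x := fun g =>
    e.measurePreserving.integral_comp e.toHomeomorph.measurableEmbedding g
  have hD : ∀ p, ‖fderiv ℝ (fun p => f (e p)) p‖ = ‖fderiv ℝ f (e p)‖ := fun p => by
    have : fderiv ℝ (fun p => f (e p)) p = (fderiv ℝ f (e p)).comp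
        (e.toContinuousLinearEquiv : E →L[ℝ] F) :=
      (((hf.differentiable one_ne_zero) (e p)).hasFDerivAt.comp p
        e.toContinuousLinearEquiv.hasFDerivAt).fderiv
    rw [this]
    exact (fderiv ℝ f (e p)).opNorm_comp_linearIsometryEquiv e
  simp only [hD] at key
  rwa [hInt (fun x => f x ^ 2 * w x), hInt w, hInt (fun x => f x * w x),
    hInt (fun x => ‖fderiv ℝ f x‖ ^ 2 * w x)] at key

theorem hasLogConcavePoincare_euclideanSpace_one {k d : ℝ} (hk : 0 < k) (hkd : k * d < π) :
    HasLogConcavePoincare (EuclideanSpace ℝ (Fin 1)) k d :=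
  (hasLogConcavePoincare_real hk hkd).of_linearIsometryEquiv
    (OrthonormalBasis.singleton (Fin 1) ℝ).repr

namespace IsLogConcaveWeight

section Restrict

variable {E : Type*} [NormedAddCommGroup E] [NormedSpace ℝ E] [MeasurableSpace E] {w : E → ℝ}
  {d : ℝ}

theorem indicator (hw : IsLogConcaveWeight w d) {S : Set E} (hS : Convex ℝ S)
    (hSm : MeasurableSet S) : IsLogConcaveWeight (S.indicator w) d where
  measurable := hw.measurable.indicator hSm
  nonneg := Set.indicator_nonneg fun x _ => hw.nonneg x
  bdd := hw.bdd.imp fun _ hM x => (Set.indicator_le_self' (fun x _ => hw.nonneg x) x).trans (hM x)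
  dist_le x y hx hy := hw.dist_le x y
    (hx.trans_le (Set.indicator_le_self' (fun x _ => hw.nonneg x) x))
    (hy.trans_le (Set.indicator_le_self' (fun x _ => hw.nonneg x) y))
  rpow_mul_rpow_le x y a b ha hb hab := by
    by_cases hx : x ∈ S
    · by_cases hy : y ∈ S
      · rw [Set.indicator_of_mem hx, Set.indicator_of_mem hy,
          Set.indicator_of_mem (hS hx hy ha.le hb.le hab)]
        exact hw.rpow_mul_rpow_le x y a b ha hb hab
      · rw [Set.indicator_of_notMem hy, zero_rpow hb.ne', mul_zero]
        exact Set.indicator_nonneg (fun x _ => hw.nonneg x) _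
    · rw [Set.indicator_of_notMem hx, zero_rpow ha.ne', zero_mul]
      exact Set.indicator_nonneg (fun x _ => hw.nonneg x) _

end Restrict

end IsLogConcaveWeight

section PlaneDir

variable {E : Type*} [NormedAddCommGroup E] [InnerProductSpace ℝ E]

/-- The normal direction at angle `θ` in the plane spanned by `u` and `v`. -/
noncomputable def planeDir (u v : E) (θ : ℝ) : E := cos θ • u + sin θ • v

theorem continuous_planeDir (u v : E) : Continuous (planeDir u v) := by
  unfold planeDir
  fun_prop

theorem planeDir_add_pi (u v : E) (θ : ℝ) : planeDir u v (θ + π) = -planeDir u v θ := by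
  simp [planeDir]
  abel

theorem norm_planeDir {u v : E} (hu : ‖u‖ = 1) (hv : ‖v‖ = 1) (huv : ⟪u, v⟫ = 0) (θ : ℝ) :
    ‖planeDir u v θ‖ = 1 := by
  rw [← sq_eq_sq₀ (norm_nonneg _) zero_le_one, planeDir, norm_add_sq_real, inner_smul_left,
    inner_smul_right, huv, norm_smul, norm_smul, hu, hv]
  simp

end PlaneDir

section Bisection

variable {E : Type*} [NormedAddCommGroup E] [InnerProductSpace ℝ E] [FiniteDimensional ℝ E]
  [MeasurableSpace E] [BorelSpace E]

theorem ae_inner_sub_ne_zero {ν : E} (hν : ν ≠ 0) (p : E) : ∀ᵐ x : E, ⟪ν, x - p⟫ ≠ 0 := by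
  have h := Measure.addHaar_affineSubspace (volume : Measure E)
    (AffineSubspace.mk' p (Submodule.span ℝ {ν})ᗮ) (by
      intro htop
      have : ν + p ∈ AffineSubspace.mk' p (Submodule.span ℝ {ν})ᗮ :=
        htop ▸ AffineSubspace.mem_top ..
      rw [AffineSubspace.mem_mk', Submodule.mem_orthogonal_singleton_iff_inner_right] at this
      simp [hν] at this)
  rw [ae_iff]
  refine measure_mono_null (fun x hx => ?_) h
  simp only [ne_eq, not_not, Set.mem_ofPred_eq] at hx
  simpa [AffineSubspace.mem_mk', Submodule.mem_orthogonal_singleton_iff_inner_right] using hx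

theorem exists_setIntegral_halfSpace_eq_zero {u v : E} (hu : ‖u‖ = 1) (hv : ‖v‖ = 1)
    (huv : ⟪u, v⟫ = 0) {h : E → ℝ} (hi : Integrable h) (h0 : ∫ x, h x = 0) (p : E) :
    ∃ θ, ∫ x in {x | ⟪planeDir u v θ, x - p⟫ ≤ 0}, h x = 0 := by
  have hne : ∀ θ, planeDir u v θ ≠ 0 := fun θ hθ => by
    simpa [hθ] using norm_planeDir hu hv huv θ
  have hm : ∀ θ, MeasurableSet {x | ⟪planeDir u v θ, x - p⟫ ≤ 0} := fun θ =>
    (isClosed_le (by fun_prop) continuous_const).measurableSet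
  set g : ℝ → ℝ := fun θ => ∫ x in {x | ⟪planeDir u v θ, x - p⟫ ≤ 0}, h x with hg
  have hgi : g = fun θ => ∫ x, {x | ⟪planeDir u v θ, x - p⟫ ≤ 0}.indicator h x :=
    funext fun θ => (integral_indicator (hm θ)).symm
  have hc : Continuous g := by
    rw [hgi, continuous_iff_continuousAt]
    intro θ₀
    refine continuousAt_of_dominated (bound := fun x => ‖h x‖)
      (Eventually.of_forall fun θ => (hi.indicator (hm θ)).aestronglyMeasurable)
      (Eventually.of_forall fun θ => Eventually.of_forall fun x => norm_indicator_le_norm_self h x)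
      hi.norm ?_
    filter_upwards [ae_inner_sub_ne_zero (hne θ₀) p] with x hx
    have ci : Continuous fun θ => ⟪planeDir u v θ, x - p⟫ :=
      (continuous_planeDir u v).inner continuous_const
    rcases lt_or_gt_of_ne hx with hx | hx
    · refine (continuousAt_const (y := h x)).congr ?_
      filter_upwards [ci.continuousAt.eventually_lt continuousAt_const hx] with θ hθ
      exact (Set.indicator_of_mem (show x ∈ {x | ⟪planeDir u v θ, x - p⟫ ≤ 0} from hθ.le) h).symm
    · refine (continuousAt_const (y := (0 : ℝ))).congr ?_
      filter_upwards [continuousAt_const.eventually_lt ci.continuousAt hx] with θ hθ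
      exact (Set.indicator_of_notMem
        (show x ∉ {x | ⟪planeDir u v θ, x - p⟫ ≤ 0} from not_le.2 hθ) h).symm
  have hpi : g (0 + π) = -g 0 := by
    have e1 : g (0 + π) = ∫ x in {x | ⟪planeDir u v 0, x - p⟫ ≤ 0}ᶜ, h x := by
      refine setIntegral_congr_set ?_
      filter_upwards [ae_inner_sub_ne_zero (hne 0) p] with x hx
      apply propext
      change ⟪planeDir u v (0 + π), x - p⟫ ≤ 0 ↔ ¬ ⟪planeDir u v 0, x - p⟫ ≤ 0
      rw [planeDir_add_pi, inner_neg_left, not_le, neg_nonpos]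
      exact ⟨fun h => lt_of_le_of_ne h hx.symm, le_of_lt⟩
    rw [e1, eq_neg_iff_add_eq_zero, add_comm, hg]
    exact (integral_add_compl (hm 0) hi).trans h0
  rcases le_total (g 0) 0 with hle | hle
  · exact mem_range_of_exists_le_of_exists_ge hc ⟨0, hle⟩
      ⟨0 + π, show 0 ≤ g (0 + π) by rw [hpi]; linarith⟩
  · exact mem_range_of_exists_le_of_exists_ge hc
      ⟨0 + π, show g (0 + π) ≤ 0 by rw [hpi]; linarith⟩ ⟨0, hle⟩

theorem IsLogConcaveWeight.integral_nonneg_of_bisection {u v : E} (hu : ‖u‖ = 1) (hv : ‖v‖ = 1)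
    (huv : ⟪u, v⟫ = 0) {f G : E → ℝ} (hf : Continuous f) (hG : Continuous G) {d : ℝ}
    (l : List E) {w : E → ℝ} (hw : IsLogConcaveWeight w d) (hmean : ∫ x, f x * w x = 0)
    (h : ∀ w' : E → ℝ, IsLogConcaveWeight w' d → (∀ x, 0 < w' x → 0 < w x) →
      ∫ x, f x * w' x = 0 →
      (∀ p ∈ l, ∃ θ, ∀ x, 0 < w' x → ⟪planeDir u v θ, x - p⟫ ≤ 0) → 0 ≤ ∫ x, G x * w' x) :
    0 ≤ ∫ x, G x * w x := by
  induction l generalizing w with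
  | nil => exact h w hw (fun _ hx => hx) hmean (by simp)
  | cons p l ih =>
    obtain ⟨θ, hθ⟩ := exists_setIntegral_halfSpace_eq_zero hu hv huv
      (hw.integrable_mul volume hf) hmean p
    set S : Set E := {x | ⟪planeDir u v θ, x - p⟫ ≤ 0} with hS
    have hSm : MeasurableSet S := (isClosed_le (by fun_prop) continuous_const).measurableSet
    have hlin : ∀ (x y : E) (a b : ℝ), a + b = 1 → ⟪planeDir u v θ, a • x + b • y - p⟫ =
        a * ⟪planeDir u v θ, x - p⟫ + b * ⟪planeDir u v θ, y - p⟫ := fun x y a b hab => by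
      simp only [inner_sub_right, inner_add_right, inner_smul_right]
      linear_combination ⟪planeDir u v θ, p⟫ * hab
    have hSc : Convex ℝ S := fun x hx y hy a b ha hb hab => by
      simp only [hS, Set.mem_ofPred_eq] at hx hy ⊢
      rw [hlin x y a b hab]
      nlinarith
    have hSc' : Convex ℝ Sᶜ := convex_iff_forall_pos.2 fun x hx y hy a b ha hb hab => by
      simp only [hS, Set.mem_compl_iff, Set.mem_ofPred_eq, not_le] at hx hy ⊢
      rw [hlin x y a b hab]
      positivity
    have hsplit : ∀ (T : Set E), MeasurableSet T → ∀ g : E → ℝ,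
        ∫ x, g x * T.indicator w x = ∫ x in T, g x * w x := fun T hT g => by
      rw [← integral_indicator hT]
      refine integral_congr_ae (Eventually.of_forall fun x => ?_)
      by_cases hx : x ∈ T <;> simp [hx]
    have hpos : ∀ (T : Set E) x, 0 < T.indicator w x → x ∈ T ∧ 0 < w x := fun T x hx => by
      by_cases hxT : x ∈ T
      · exact ⟨hxT, by simpa [hxT] using hx⟩
      · simp [hxT] at hx
    have hθ' : ∫ x in Sᶜ, f x * w x = 0 := by
      have := integral_add_compl hSm (hw.integrable_mul volume hf)
      linarith
    have h1 := ih (hw.indicator hSc hSm) ((hsplit S hSm f).trans hθ)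
      fun w' hw' hsub hm hl => h w' hw' (fun x hx => (hpos S x (hsub x hx)).2) hm fun q hq => by
        rcases List.mem_cons.1 hq with rfl | hq
        · exact ⟨θ, fun x hx => (hpos S x (hsub x hx)).1⟩
        · exact hl q hq
    have h2 := ih (hw.indicator hSc' hSm.compl) ((hsplit Sᶜ hSm.compl f).trans hθ')
      fun w' hw' hsub hm hl => h w' hw' (fun x hx => (hpos Sᶜ x (hsub x hx)).2) hm fun q hq => by
        rcases List.mem_cons.1 hq with rfl | hq
        · refine ⟨θ + π, fun x hx => ?_⟩
          have := (hpos Sᶜ x (hsub x hx)).1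
          simp only [hS, Set.mem_compl_iff, Set.mem_ofPred_eq, not_le] at this
          rw [planeDir_add_pi, inner_neg_left]
          linarith
        · exact hl q hq
    rw [hsplit S hSm] at h1
    rw [hsplit Sᶜ hSm.compl] at h2
    rw [← integral_add_compl hSm (hw.integrable_mul volume hG)]
    exact add_nonneg h1 h2

end Bisection

theorem sq_det_le {α β B₀ B₁ C₀ C₁ r t δ ℓ : ℝ} (h : β ^ 2 + α ^ 2 = 1)
    (hr : r = α * B₀ + β * B₁) (ht : t = α * C₀ + β * C₁) (hB : B₀ ^ 2 + B₁ ^ 2 = ℓ ^ 2)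
    (hC : C₀ ^ 2 + C₁ ^ 2 ≤ 4 * ℓ ^ 2) (hr2 : r ^ 2 ≤ 9 * δ ^ 2) (ht2 : t ^ 2 ≤ 9 * δ ^ 2) :
    (B₀ * C₁ - B₁ * C₀) ^ 2 ≤ (10 * δ * ℓ) ^ 2 := by
  have hdet : (B₀ * C₁ - B₁ * C₀) ^ 2 = (r * C₁ - t * B₁) ^ 2 + (t * B₀ - r * C₀) ^ 2 := by
    have h1 : α * (B₀ * C₁ - B₁ * C₀) = r * C₁ - t * B₁ := by rw [hr, ht]; ring
    have h2 : β * (B₀ * C₁ - B₁ * C₀) = t * B₀ - r * C₀ := by rw [hr, ht]; ring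
    rw [← h1, ← h2]
    linear_combination -(B₀ * C₁ - B₁ * C₀) ^ 2 * h
  have h1 : (B₀ * C₁ - B₁ * C₀) ^ 2 ≤
      2 * (r ^ 2 * (C₀ ^ 2 + C₁ ^ 2) + t ^ 2 * (B₀ ^ 2 + B₁ ^ 2)) := by
    rw [hdet]
    linarith [sq_nonneg (r * C₁ + t * B₁), sq_nonneg (t * B₀ + r * C₀)]
  have h2 : r ^ 2 * (C₀ ^ 2 + C₁ ^ 2) ≤ 9 * δ ^ 2 * (4 * ℓ ^ 2) := by gcongr
  have h3 : t ^ 2 * (B₀ ^ 2 + B₁ ^ 2) ≤ 9 * δ ^ 2 * ℓ ^ 2 := by rw [hB]; gcongr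
  have h4 : 0 ≤ δ ^ 2 * ℓ ^ 2 := by positivity
  linarith

/-- A convex set that, through each of its points, is almost on one side of a line direction in
the plane spanned by `u` and `v` is close to a hyperplane. -/
theorem exists_thin_direction {E : Type*} [NormedAddCommGroup E] [InnerProductSpace ℝ E]
    {u v : E} (hu : ‖u‖ = 1) (hv : ‖v‖ = 1) (huv : ⟪u, v⟫ = 0) {T : Set E} (hT : Convex ℝ T)
    {d : ℝ} (hd : ∀ x ∈ T, ∀ y ∈ T, dist x y ≤ d) {δ : ℝ} (hδ : 0 ≤ δ)
    (h : ∀ g ∈ T, ∃ θ, ∀ x ∈ T, ⟪planeDir u v θ, x - g⟫ ≤ δ) :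
    ∃ N : E, ‖N‖ = 1 ∧ ∃ t₀, ∀ x ∈ T, |t₀ - ⟪x, N⟫| ≤ 10 * δ := by
  rcases T.eq_empty_or_nonempty with rfl | ⟨z, hz⟩
  · exact ⟨u, hu, 0, by simp⟩
  set Q : E → ℝ := fun x => ⟪u, x⟫ ^ 2 + ⟪v, x⟫ ^ 2 with hQ
  have hQ0 : ∀ x, 0 ≤ Q x := fun x => by positivity
  have hQle : ∀ x ∈ T, ∀ y ∈ T, Q (y - x) ≤ 2 * d ^ 2 := fun x hx y hy => by
    have h1 : |⟪u, y - x⟫| ≤ d := (abs_real_inner_le_norm _ _).trans (by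
      rw [hu, one_mul, ← dist_eq_norm]; exact hd y hy x hx)
    have h2 : |⟪v, y - x⟫| ≤ d := (abs_real_inner_le_norm _ _).trans (by
      rw [hv, one_mul, ← dist_eq_norm]; exact hd y hy x hx)
    have := sq_le_sq' (abs_le.1 h1).1 (abs_le.1 h1).2
    have := sq_le_sq' (abs_le.1 h2).1 (abs_le.1 h2).2
    simp only [hQ]
    linarith
  by_cases hall : ∀ x ∈ T, ∀ y ∈ T, Q (y - x) = 0
  · refine ⟨u, hu, ⟪z, u⟫, fun x hx => ?_⟩
    have h1 := hall x hx z hz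
    have h2 : ⟪u, z - x⟫ = 0 := by
      simp only [hQ] at h1
      nlinarith [sq_nonneg ⟪u, z - x⟫, sq_nonneg ⟪v, z - x⟫]
    rw [← inner_sub_left, real_inner_comm, h2, abs_zero]
    positivity
  push Not at hall
  obtain ⟨x₁, hx₁, y₁, hy₁, hne⟩ := hall
  set V : Set ℝ := {r | ∃ x ∈ T, ∃ y ∈ T, r = Q (y - x)} with hV
  have hVb : BddAbove V := ⟨2 * d ^ 2, by rintro r ⟨x, hx, y, hy, rfl⟩; exact hQle x hx y hy⟩
  have hVm : Q (y₁ - x₁) ∈ V := ⟨x₁, hx₁, y₁, hy₁, rfl⟩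
  have hspos : 0 < sSup V := (lt_of_le_of_ne (hQ0 _) hne.symm).trans_le (le_csSup hVb hVm)
  obtain ⟨_, ⟨a, ha, b, hb, rfl⟩, hab⟩ :=
    exists_lt_of_lt_csSup ⟨_, hVm⟩ (show sSup V / 4 < sSup V by linarith)
  have hsup : ∀ c ∈ T, Q (c - a) ≤ 4 * Q (b - a) := fun c hc => by
    have := le_csSup hVb (show Q (c - a) ∈ V from ⟨a, ha, c, hc, rfl⟩)
    linarith
  set ℓ := √(Q (b - a)) with hℓ
  have hQpos : 0 < Q (b - a) := by linarith
  have hℓpos : 0 < ℓ := sqrt_pos.2 hQpos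
  have hℓsq : ℓ ^ 2 = Q (b - a) := sq_sqrt hQpos.le
  set B₀ := ⟪u, b - a⟫ with hB₀
  set B₁ := ⟪v, b - a⟫ with hB₁
  have hBQ : B₀ ^ 2 + B₁ ^ 2 = ℓ ^ 2 := hℓsq.symm
  refine ⟨ℓ⁻¹ • (B₀ • v - B₁ • u), ?_, ⟪a, ℓ⁻¹ • (B₀ • v - B₁ • u)⟫, fun c hc => ?_⟩
  · have : ‖B₀ • v - B₁ • u‖ = ℓ := by
      rw [← sq_eq_sq₀ (norm_nonneg _) hℓpos.le, norm_sub_sq_real, inner_smul_left,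
        inner_smul_right, real_inner_comm, huv, norm_smul, norm_smul, hu, hv, ← hBQ]
      simp
    rw [norm_smul, this, norm_inv, Real.norm_of_nonneg hℓpos.le, inv_mul_cancel₀ hℓpos.ne']
  set g : E := (1 / 3 : ℝ) • a + (2 / 3 : ℝ) • ((1 / 2 : ℝ) • b + (1 / 2 : ℝ) • c) with hg
  have hgT : g ∈ T := hT ha (hT hb hc (by norm_num) (by norm_num) (by norm_num)) (by norm_num)
    (by norm_num) (by norm_num)
  obtain ⟨θ, hθ⟩ := h g hgT
  set C₀ := ⟪u, c - a⟫ with hC₀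
  set C₁ := ⟪v, c - a⟫ with hC₁
  have hCQ : C₀ ^ 2 + C₁ ^ 2 ≤ 4 * ℓ ^ 2 := by rw [hℓsq]; exact hsup c hc
  have hexp : ∀ x, ⟪planeDir u v θ, x⟫ = cos θ * ⟪u, x⟫ + sin θ * ⟪v, x⟫ := fun x => by
    simp [planeDir, inner_add_left, inner_smul_left]
  have ga := hθ a ha
  have gb := hθ b hb
  have gc := hθ c hc
  have eg : ⟪planeDir u v θ, g⟫ =
      (⟪planeDir u v θ, a⟫ + ⟪planeDir u v θ, b⟫ + ⟪planeDir u v θ, c⟫) / 3 := by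
    simp only [hg, inner_add_right, inner_smul_right]
    ring
  rw [inner_sub_right, eg] at ga gb gc
  have hr : |cos θ * B₀ + sin θ * B₁| ≤ 3 * δ := by
    rw [hB₀, hB₁, ← hexp, inner_sub_right, abs_le]
    constructor <;> linarith
  have ht : |cos θ * C₀ + sin θ * C₁| ≤ 3 * δ := by
    rw [hC₀, hC₁, ← hexp, inner_sub_right, abs_le]
    constructor <;> linarith
  set r := cos θ * B₀ + sin θ * B₁ with hrdef
  set t := cos θ * C₀ + sin θ * C₁ with htdef
  have hr2 : r ^ 2 ≤ 9 * δ ^ 2 := by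
    have := sq_le_sq' (abs_le.1 hr).1 (abs_le.1 hr).2
    linarith
  have ht2 : t ^ 2 ≤ 9 * δ ^ 2 := by
    have := sq_le_sq' (abs_le.1 ht).1 (abs_le.1 ht).2
    linarith
  have hfin := sq_det_le (sin_sq_add_cos_sq θ) hrdef htdef hBQ hCQ hr2 ht2
  have hval : ⟪a, ℓ⁻¹ • (B₀ • v - B₁ • u)⟫ - ⟪c, ℓ⁻¹ • (B₀ • v - B₁ • u)⟫ =
      -(ℓ⁻¹ * (B₀ * C₁ - B₁ * C₀)) := by
    rw [hC₁, hC₀]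
    simp only [inner_smul_right, inner_sub_right, real_inner_comm a, real_inner_comm c]
    ring
  rw [hval, abs_neg, abs_mul, abs_inv, abs_of_pos hℓpos, inv_mul_le_iff₀ hℓpos]
  exact (abs_le_of_sq_le_sq hfin (by positivity)).trans_eq (by ring)

section Induction

variable {E F : Type*} [NormedAddCommGroup E] [InnerProductSpace ℝ E] [FiniteDimensional ℝ E]
  [MeasurableSpace E] [BorelSpace E] [NormedAddCommGroup F] [InnerProductSpace ℝ F]
  [FiniteDimensional ℝ F] [MeasurableSpace F] [BorelSpace F]

theorem IsLogConcaveWeight.poincare_of_mean_zero {k d : ℝ} (hF : HasLogConcavePoincare F k d)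
    (hEF : ∀ N : E, ‖N‖ = 1 → ∃ A : F →ₗᵢ[ℝ] E, (∀ y, ⟪A y, N⟫ = 0) ∧
      MeasurePreserving (fun p : F × ℝ => A p.1 + p.2 • N) volume volume)
    {u v : E} (hu : ‖u‖ = 1) (hv : ‖v‖ = 1) (huv : ⟪u, v⟫ = 0)
    {w : E → ℝ} (hw : IsLogConcaveWeight w d) {f : E → ℝ} (hf : ContDiff ℝ 1 f)
    (hmean : ∫ x, f x * w x = 0) :
    k ^ 2 * ∫ x, f x ^ 2 * w x ≤ ∫ x, ‖fderiv ℝ f x‖ ^ 2 * w x := by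
  have cf := hf.continuous
  have cf' : Continuous fun x => ‖fderiv ℝ f x‖ ^ 2 :=
    (hf.continuous_fderiv (by norm_num)).norm.pow 2
  have key : ∀ η : ℝ, 0 < η → k ^ 2 * ∫ x, f x ^ 2 * w x ≤
      (∫ x, ‖fderiv ℝ f x‖ ^ 2 * w x) + (η + k ^ 2 * (η + η ^ 2)) * ∫ x, w x := by
    intro η hη
    obtain ⟨x₀, R, hR, hsupp⟩ := hw.exists_subset_closedBall
    have hK := isCompact_closedBall x₀ (R + 1)
    have uc : ∀ g : E → ℝ, Continuous g → ∃ δ > 0, ∀ x ∈ Metric.closedBall x₀ (R + 1),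
        ∀ y ∈ Metric.closedBall x₀ (R + 1), dist x y < δ → |g x - g y| < η := fun g hg =>
      Metric.uniformContinuousOn_iff.1 (hK.uniformContinuousOn_of_continuous hg.continuousOn) η hη
    obtain ⟨δ₀, hδ₀, H0⟩ := uc f cf
    obtain ⟨δ₁, hδ₁, H1⟩ := uc (fun x => f x ^ 2) (cf.pow 2)
    obtain ⟨δ₂, hδ₂, H2⟩ := uc _ cf'
    obtain ⟨δ, hδ, hδ0, hδ1, hδ2, hδ3⟩ : ∃ δ : ℝ, 0 < δ ∧ 10 * δ < δ₀ ∧ 10 * δ < δ₁ ∧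
        10 * δ < δ₂ ∧ 10 * δ < 1 := by
      refine ⟨min (min δ₀ δ₁) (min δ₂ 1) / 11, by positivity, ?_, ?_, ?_, ?_⟩ <;>
      · have := min_le_left (min δ₀ δ₁) (min δ₂ 1)
        have := min_le_right (min δ₀ δ₁) (min δ₂ 1)
        have := min_le_left δ₀ δ₁
        have := min_le_right δ₀ δ₁
        have := min_le_left δ₂ 1
        have := min_le_right δ₂ 1
        have : 0 < min (min δ₀ δ₁) (min δ₂ 1) := by positivity
        linarith
    obtain ⟨t, -, htf, hcov⟩ := (isCompact_closedBall x₀ R).finite_cover_balls hδ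
    set c := η + k ^ 2 * (η + η ^ 2) with hc
    have split : ∀ {w' : E → ℝ}, IsLogConcaveWeight w' d →
        ∫ x, (‖fderiv ℝ f x‖ ^ 2 - k ^ 2 * f x ^ 2 + c) * w' x =
        (∫ x, ‖fderiv ℝ f x‖ ^ 2 * w' x) - k ^ 2 * (∫ x, f x ^ 2 * w' x) + c * ∫ x, w' x :=
      fun {w'} hw' => by
        have i1 := hw'.integrable_mul volume cf'
        have i2 : Integrable (fun x => k ^ 2 * (f x ^ 2 * w' x)) :=
          (hw'.integrable_mul volume (cf.pow 2)).const_mul _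
        have i3 := hw'.integrable volume
        have i4 : Integrable (fun x => ‖fderiv ℝ f x‖ ^ 2 * w' x - k ^ 2 * (f x ^ 2 * w' x)) :=
          i1.sub i2
        rw [← integral_const_mul, ← integral_const_mul, ← integral_sub i1 i2,
          ← integral_add i4 (i3.const_mul _)]
        congr 1
        ext x
        ring
    have main := hw.integral_nonneg_of_bisection hu hv huv cf
      (G := fun x => ‖fderiv ℝ f x‖ ^ 2 - k ^ 2 * f x ^ 2 + c)
      ((cf'.sub (continuous_const.mul (cf.pow 2))).add continuous_const) htf.toFinset.toList hmean
      (fun w' hw' hsub hm hl => by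
        obtain ⟨N, hN, t₀, ht₀⟩ := exists_thin_direction hu hv huv
          (hw'.convexOn_neg_log.1) (fun x hx y hy => hw'.dist_le x y hx hy) hδ.le
          (fun g hg => by
            obtain ⟨p, hp, hgp⟩ := Set.mem_iUnion₂.1 (hcov (hsupp g (hsub g hg)))
            obtain ⟨θ, hθ⟩ := hl p (by simpa using hp)
            refine ⟨θ, fun x hx => ?_⟩
            have h1 := hθ x hx
            have h2 : ⟪planeDir u v θ, p - g⟫ ≤ δ := (real_inner_le_norm _ _).trans (by
              rw [norm_planeDir hu hv huv, one_mul, ← dist_eq_norm, dist_comm]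
              exact (Metric.mem_ball.1 hgp).le)
            have h3 : x - g = (x - p) + (p - g) := by abel
            rw [h3, inner_add_right]
            linarith)
        obtain ⟨A, hA, hmp⟩ := hEF N hN
        have hdist : ∀ x, 0 < w' x → dist (x + (t₀ - ⟪x, N⟫) • N) x ≤ 10 * δ := fun x hx => by
          rw [dist_eq_norm, add_sub_cancel_left, norm_smul, hN, mul_one]
          exact ht₀ x hx
        have hx1 : ∀ x, 0 < w' x → x ∈ Metric.closedBall x₀ (R + 1) := fun x hx =>
          Metric.closedBall_subset_closedBall (by linarith) (hsupp x (hsub x hx))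
        have hx2 : ∀ x, 0 < w' x → x + (t₀ - ⟪x, N⟫) • N ∈ Metric.closedBall x₀ (R + 1) :=
          fun x hx => by
            have h1 := Metric.mem_closedBall.1 (hsupp x (hsub x hx))
            have h2 := dist_triangle (x + (t₀ - ⟪x, N⟫) • N) x x₀
            have h3 := hdist x hx
            exact Metric.mem_closedBall.2 (by linarith)
        have := hw'.poincare_of_thin hF hN hA hmp hf hm (t₀ := t₀) (η := η)
          (fun x hx => (H0 _ (hx2 x hx) _ (hx1 x hx) ((hdist x hx).trans_lt hδ0)).le)
          (fun x hx => (H1 _ (hx2 x hx) _ (hx1 x hx) ((hdist x hx).trans_lt hδ1)).le)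
          (fun x hx => by
            have := (abs_lt.1 (H2 _ (hx2 x hx) _ (hx1 x hx) ((hdist x hx).trans_lt hδ2))).2
            linarith)
        rw [split hw']
        linarith)
    rw [split hw] at main
    linarith
  have hlim : Tendsto (fun η : ℝ => (∫ x, ‖fderiv ℝ f x‖ ^ 2 * w x) +
      (η + k ^ 2 * (η + η ^ 2)) * ∫ x, w x) (nhdsWithin 0 (Set.Ioi 0))
      (nhds (∫ x, ‖fderiv ℝ f x‖ ^ 2 * w x)) := by
    have : Continuous fun η : ℝ => (∫ x, ‖fderiv ℝ f x‖ ^ 2 * w x) +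
      (η + k ^ 2 * (η + η ^ 2)) * ∫ x, w x := by fun_prop
    have h := this.tendsto 0
    simp only [ne_eq, OfNat.ofNat_ne_zero, not_false_eq_true, zero_pow, add_zero, mul_zero,
      zero_mul] at h
    exact h.mono_left nhdsWithin_le_nhds
  exact ge_of_tendsto hlim (by
    filter_upwards [self_mem_nhdsWithin] with η hη using key η hη)

theorem HasLogConcavePoincare.of_mean_zero {k d : ℝ}
    (h : ∀ (w f : E → ℝ), IsLogConcaveWeight w d → ContDiff ℝ 1 f → ∫ x, f x * w x = 0 →
      k ^ 2 * ∫ x, f x ^ 2 * w x ≤ ∫ x, ‖fderiv ℝ f x‖ ^ 2 * w x) :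
    HasLogConcavePoincare E k d := by
  intro w f hw hf
  have cf := hf.continuous
  have i0 := hw.integrable volume
  have i1 := hw.integrable_mul volume cf
  have i2 := hw.integrable_mul volume (cf.pow 2)
  simp only [Pi.pow_apply] at i2
  rcases (integral_nonneg hw.nonneg : 0 ≤ ∫ x, w x).eq_or_lt with h0 | h0
  · rw [← h0]
    nlinarith [mul_nonneg (sq_nonneg k) (sq_nonneg (∫ x, f x * w x))]
  set c := (∫ x, f x * w x) / ∫ x, w x with hc
  have hcw : c * ∫ x, w x = ∫ x, f x * w x := div_mul_cancel₀ _ h0.ne'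
  have hm : ∫ x, (f x - c) * w x = 0 := by
    simp only [sub_mul]
    rw [integral_sub i1 (i0.const_mul c), integral_const_mul, hcw, sub_self]
  have key := h w (fun x => f x - c) hw (hf.sub contDiff_const) hm
  simp only [fderiv_sub_const] at key
  have e : ∫ x, (f x - c) ^ 2 * w x =
      (∫ x, f x ^ 2 * w x) - c * ∫ x, f x * w x := by
    have : (fun x => (f x - c) ^ 2 * w x) =
        fun x => f x ^ 2 * w x - (2 * c * (f x * w x) - c ^ 2 * w x) := by
      ext x; ring
    have i3 : Integrable fun x => 2 * c * (f x * w x) - c ^ 2 * w x :=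
      (i1.const_mul _).sub (i0.const_mul _)
    rw [this, integral_sub i2 i3, integral_sub (i1.const_mul _) (i0.const_mul _),
      integral_const_mul,
      integral_const_mul, ← hcw]
    ring
  rw [e] at key
  calc _ = (∫ x, w x) * (k ^ 2 * ((∫ x, f x ^ 2 * w x) - c * ∫ x, f x * w x)) := by
        rw [← hcw]; ring
    _ ≤ _ := mul_le_mul_of_nonneg_left key h0.le

end Induction

theorem hasLogConcavePoincare_euclideanSpace {k d : ℝ} (hk : 0 < k) (hkd : k * d < π) (n : ℕ) :
    HasLogConcavePoincare (EuclideanSpace ℝ (Fin (n + 1))) k d := by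
  induction n with
  | zero => exact hasLogConcavePoincare_euclideanSpace_one hk hkd
  | succ n ih =>
    have h01 : ⟪(EuclideanSpace.single 0 1 : EuclideanSpace ℝ (Fin (n + 1 + 1))),
        EuclideanSpace.single 1 1⟫ = 0 := by
      rw [EuclideanSpace.inner_single_left]
      simp
    exact HasLogConcavePoincare.of_mean_zero fun w f hw hf hm =>
      hw.poincare_of_mean_zero ih
        (fun N hN => EuclideanSpace.exists_measurePreserving_prod hN) (by simp) (by simp) h01 hf hm

section SmoothApproximation

variable {E : Type*} [NormedAddCommGroup E] [InnerProductSpace ℝ E] [FiniteDimensional ℝ E]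
  [MeasurableSpace E] [BorelSpace E]

open scoped Convolution in
/-- Mollification: a compactly supported `C¹` function is a `C¹` limit of smooth functions
supported in an arbitrarily small thickening of its support. -/
theorem exists_contDiff_approx_of_hasCompactSupport {φ : E → ℝ} (hφ : ContDiff ℝ 1 φ)
    (hK : HasCompactSupport φ) {δ η : ℝ} (hδ : 0 < δ) (hη : 0 < η) :
    ∃ ψ : E → ℝ, ContDiff ℝ (⊤ : ℕ∞) ψ ∧ tsupport ψ ⊆ Metric.cthickening δ (tsupport φ) ∧
      (∀ x, |ψ x - φ x| ≤ η) ∧ ∀ x, ‖fderiv ℝ ψ x - fderiv ℝ φ x‖ ≤ η := by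
  have cφ := hφ.continuous
  have cφ' : Continuous (fderiv ℝ φ) := hφ.continuous_fderiv (by norm_num)
  obtain ⟨δ₁, hδ₁, H1⟩ := Metric.uniformContinuous_iff.1
    (HasCompactSupport.uniformContinuous_of_continuous hK cφ) η hη
  obtain ⟨δ₂, hδ₂, H2⟩ := Metric.uniformContinuous_iff.1
    (HasCompactSupport.uniformContinuous_of_continuous (hK.fderiv ℝ) cφ') η hη
  have hr : 0 < min δ (min δ₁ δ₂) := by positivity
  let b : ContDiffBump (0 : E) := ⟨min δ (min δ₁ δ₂) / 2, min δ (min δ₁ δ₂), by positivity,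
    by linarith⟩
  have hbr : b.rOut = min δ (min δ₁ δ₂) := rfl
  have hrδ : b.rOut ≤ δ := min_le_left _ _
  have hr1 : b.rOut ≤ δ₁ := (min_le_right _ _).trans (min_le_left _ _)
  have hr2 : b.rOut ≤ δ₂ := (min_le_right _ _).trans (min_le_right _ _)
  have hbl : LocallyIntegrable (b.normed volume) volume := b.continuous_normed.locallyIntegrable
  refine ⟨b.normed volume ⋆[ContinuousLinearMap.lsmul ℝ ℝ, volume] φ, ?_, ?_, fun x => ?_,
    fun x => ?_⟩
  · exact b.hasCompactSupport_normed.contDiff_convolution_left _ b.contDiff_normed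
      cφ.locallyIntegrable
  · refine closure_minimal (fun x hx => ?_) Metric.isClosed_cthickening
    obtain ⟨a, ha, y, hy, rfl⟩ := support_convolution_subset _ hx
    rw [b.support_normed_eq] at ha
    refine Metric.mem_cthickening_of_dist_le _ y _ _ (subset_tsupport _ hy) ?_
    rw [dist_eq_norm, add_sub_cancel_right, ← dist_zero_right]
    exact (Metric.mem_ball.1 ha).le.trans hrδ
  · rw [← Real.dist_eq]
    exact b.dist_normed_convolution_le cφ.aestronglyMeasurable fun y hy =>
      (H1 ((Metric.mem_ball.1 hy).trans_le hr1)).le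
  · rw [(hK.hasFDerivAt_convolution_right _ hbl hφ x).fderiv, ← dist_eq_norm]
    have : (ContinuousLinearMap.lsmul ℝ ℝ : ℝ →L[ℝ] ℝ →L[ℝ] ℝ).precompR E =
        (ContinuousLinearMap.lsmul ℝ ℝ : ℝ →L[ℝ] (E →L[ℝ] ℝ) →L[ℝ] (E →L[ℝ] ℝ)) := by
      ext; simp
    rw [this]
    exact b.dist_normed_convolution_le cφ'.aestronglyMeasurable fun y hy =>
      (H2 ((Metric.mem_ball.1 hy).trans_le hr2)).le

/-- A weak equation tested against smooth functions also holds for compactly supported `C¹` test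
functions. -/
theorem setIntegral_eq_of_contDiff_one {μ : Measure E} [IsFiniteMeasureOnCompacts μ] {Ω : Set E}
    (hΩ : IsOpen Ω) {X : E → E} {h : E → ℝ} (hX : ContinuousOn X Ω) (hh : ContinuousOn h Ω)
    (H : ∀ φ : E → ℝ, ContDiff ℝ (⊤ : ℕ∞) φ → HasCompactSupport φ → tsupport φ ⊆ Ω →
      ∫ x in Ω, ⟪X x, gradient φ x⟫ ∂μ = ∫ x in Ω, h x * φ x ∂μ)
    {φ : E → ℝ} (hφ : ContDiff ℝ 1 φ) (hK : HasCompactSupport φ) (hS : tsupport φ ⊆ Ω) :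
    ∫ x in Ω, ⟪X x, gradient φ x⟫ ∂μ = ∫ x in Ω, h x * φ x ∂μ := by
  obtain ⟨δ, hδ, hδΩ⟩ := hK.isCompact.exists_cthickening_subset_open hΩ hS
  set K := Metric.cthickening δ (tsupport φ) with hKdef
  have hKc : IsCompact K := hK.isCompact.cthickening
  have hKm : MeasurableSet K := hKc.measurableSet
  have hφK : tsupport φ ⊆ K := Metric.self_subset_cthickening _
  have cgrad : ∀ {ψ : E → ℝ}, ContDiff ℝ 1 ψ → Continuous (gradient ψ) := fun {ψ} hψ =>
    (InnerProductSpace.toDual ℝ E).symm.continuous.comp (hψ.continuous_fderiv (by norm_num))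
  have hzero : ∀ {ψ : E → ℝ}, tsupport ψ ⊆ K → ∀ x ∉ K, ψ x = 0 ∧ gradient ψ x = 0 :=
    fun {ψ} hψ x hx => by
      have hx' : x ∉ tsupport ψ := fun h => hx (hψ h)
      exact ⟨image_eq_zero_of_notMem_tsupport hx', by
        rw [gradient, (notMem_tsupport_iff_eventuallyEq.1 hx').fderiv_eq]; simp⟩
  have hred : ∀ {ψ : E → ℝ}, ContDiff ℝ 1 ψ → tsupport ψ ⊆ K →
      (∫ x in Ω, ⟪X x, gradient ψ x⟫ ∂μ) - ∫ x in Ω, h x * ψ x ∂μ =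
        ∫ x in K, (⟪X x, gradient ψ x⟫ - h x * ψ x) ∂μ := fun {ψ} hψ hψK => by
    rw [setIntegral_eq_of_subset_of_forall_sdiff_eq_zero hΩ.measurableSet hδΩ
        (fun x hx => by rw [(hzero hψK x hx.2).2, inner_zero_right]),
      setIntegral_eq_of_subset_of_forall_sdiff_eq_zero hΩ.measurableSet hδΩ
        (fun x hx => by rw [(hzero hψK x hx.2).1, mul_zero])]
    refine (integral_sub ?_ ?_).symm
    · exact ((hX.mono hδΩ).inner (cgrad hψ).continuousOn).integrableOn_compact hKc
    · exact ((hh.mono hδΩ).mul hψ.continuous.continuousOn).integrableOn_compact hKc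
  obtain ⟨M₁, hM₁⟩ := hKc.exists_bound_of_continuousOn (hX.mono hδΩ)
  obtain ⟨M₂, hM₂⟩ := hKc.exists_bound_of_continuousOn (hh.mono hδΩ)
  have hInt : ∀ {ψ : E → ℝ}, ContDiff ℝ 1 ψ →
      IntegrableOn (fun x => ⟪X x, gradient ψ x⟫ - h x * ψ x) K μ := fun {ψ} hψ =>
    (((hX.mono hδΩ).inner (cgrad hψ).continuousOn).sub
      ((hh.mono hδΩ).mul hψ.continuous.continuousOn)).integrableOn_compact hKc
  have key : ∀ η : ℝ, 0 < η → ‖∫ x in K, (⟪X x, gradient φ x⟫ - h x * φ x) ∂μ‖ ≤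
      (M₁ * η + M₂ * η) * μ.real K := by
    intro η hη
    obtain ⟨ψ, hψ, hψK, hψ0, hψ1⟩ := exists_contDiff_approx_of_hasCompactSupport hφ hK hδ hη
    have hψC : ContDiff ℝ 1 ψ := hψ.of_le (by exact_mod_cast le_top)
    have e0 : ∫ x in K, (⟪X x, gradient ψ x⟫ - h x * ψ x) ∂μ = 0 := by
      rw [← hred hψC hψK, H ψ hψ (hKc.of_isClosed_subset (isClosed_tsupport _) hψK)
        (hψK.trans hδΩ), sub_self]
    rw [← sub_zero (∫ x in K, (⟪X x, gradient φ x⟫ - h x * φ x) ∂μ), ← e0,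
      ← integral_sub (hInt hφ) (hInt hψC)]
    refine norm_setIntegral_le_of_norm_le_const hKc.measure_lt_top fun x hx => ?_
    have e1 : ⟪X x, gradient φ x⟫ - h x * φ x - (⟪X x, gradient ψ x⟫ - h x * ψ x) =
        h x * (ψ x - φ x) - ⟪X x, gradient ψ x - gradient φ x⟫ := by
      rw [inner_sub_right]; ring
    have e2 : ‖gradient ψ x - gradient φ x‖ ≤ η := by
      rw [gradient, gradient, ← map_sub, LinearIsometryEquiv.norm_map]
      exact hψ1 x
    rw [e1]
    calc _ ≤ ‖h x * (ψ x - φ x)‖ + ‖⟪X x, gradient ψ x - gradient φ x⟫‖ := norm_sub_le _ _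
      _ ≤ ‖h x‖ * ‖ψ x - φ x‖ + ‖X x‖ * ‖gradient ψ x - gradient φ x‖ :=
        add_le_add (norm_mul_le _ _) (norm_inner_le_norm _ _)
      _ ≤ M₂ * η + M₁ * η := by
        have := hM₁ x hx
        have := hM₂ x hx
        have := hψ0 x
        have : 0 ≤ M₁ := (norm_nonneg _).trans (hM₁ x hx)
        have : 0 ≤ M₂ := (norm_nonneg _).trans (hM₂ x hx)
        rw [Real.norm_eq_abs (ψ x - φ x)]
        gcongr
      _ = _ := add_comm _ _
  rw [← sub_eq_zero, hred hφ hφK, ← norm_le_zero_iff]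
  have hlim : Tendsto (fun η : ℝ => (M₁ * η + M₂ * η) * μ.real K) (nhdsWithin 0 (Set.Ioi 0))
      (nhds 0) := by
    have : Continuous fun η : ℝ => (M₁ * η + M₂ * η) * μ.real K := by fun_prop
    have h := this.tendsto 0
    simp only [mul_zero, add_zero, zero_mul] at h
    exact h.mono_left nhdsWithin_le_nhds
  exact ge_of_tendsto hlim (by
    filter_upwards [self_mem_nhdsWithin] with η hη using key η hη)

end SmoothApproximation

section Gaussian

/-- The density of the standard Gaussian measure. -/
noncomputable def gaussDensity (n : ℕ) (x : EuclideanSpace ℝ (Fin n)) : ℝ :=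
  (2 * π) ^ (-(n : ℝ) / 2) * exp (-‖x‖ ^ 2 / 2)

theorem continuous_gaussDensity (n : ℕ) : Continuous (gaussDensity n) := by
  unfold gaussDensity
  fun_prop

theorem gaussDensity_pos {n : ℕ} (x : EuclideanSpace ℝ (Fin n)) : 0 < gaussDensity n x := by
  unfold gaussDensity
  positivity

theorem log_gaussDensity {n : ℕ} (x : EuclideanSpace ℝ (Fin n)) :
    log (gaussDensity n x) = log ((2 * π) ^ (-(n : ℝ) / 2)) - ‖x‖ ^ 2 / 2 := by
  rw [gaussDensity, log_mul (by positivity) (exp_pos _).ne', log_exp]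
  ring

instance (n : ℕ) : IsLocallyFiniteMeasure (gaussMeasure n) :=
  IsLocallyFiniteMeasure.withDensity_ofReal (continuous_gaussDensity n)

theorem setIntegral_gaussMeasure {n : ℕ} {Ω : Set (EuclideanSpace ℝ (Fin n))}
    (hΩ : MeasurableSet Ω) (g : EuclideanSpace ℝ (Fin n) → ℝ) :
    ∫ x in Ω, g x ∂(gaussMeasure n) = ∫ x in Ω, gaussDensity n x * g x := by
  have h := setIntegral_withDensity_eq_setIntegral_toReal_smul (μ := volume)
    (f := fun x => ENNReal.ofReal (gaussDensity n x))
    (continuous_gaussDensity n).measurable.ennreal_ofReal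
    (Eventually.of_forall fun x => ENNReal.ofReal_lt_top) g hΩ
  refine h.trans (integral_congr_ae (Eventually.of_forall fun x => ?_))
  simp only [ENNReal.toReal_ofReal (gaussDensity_pos x).le, smul_eq_mul]

theorem isLogConcaveWeight_gaussDensity_mul_sq {n : ℕ} {Ω : Set (EuclideanSpace ℝ (Fin n))}
    (hΩo : IsOpen Ω) (hΩb : Bornology.IsBounded Ω) {g : EuclideanSpace ℝ (Fin n) → ℝ}
    (hpos : ∀ x ∈ Ω, 0 < g x) (hcont : ContinuousOn g (closure Ω))
    (hlc : ConcaveOn ℝ Ω fun x => log (g x)) :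
    IsLogConcaveWeight (Ω.indicator fun x => gaussDensity n x * g x ^ 2) (Metric.diam Ω) := by
  classical
  have hmem : ∀ x, 0 < Ω.indicator (fun x => gaussDensity n x * g x ^ 2) x → x ∈ Ω :=
    fun x hx => by
      by_contra h
      rw [Set.indicator_of_notMem h] at hx
      exact hx.false
  have hnn : ∀ x, 0 ≤ gaussDensity n x * g x ^ 2 := fun x =>
    mul_nonneg (gaussDensity_pos x).le (sq_nonneg _)
  have hc : ContinuousOn (fun x => gaussDensity n x * g x ^ 2) (closure Ω) :=
    (continuous_gaussDensity n).continuousOn.mul (hcont.pow 2)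
  refine ⟨?_, Set.indicator_nonneg fun x _ => hnn x, ?_, fun x y hx hy =>
    Metric.dist_le_diam_of_mem hΩb (hmem x hx) (hmem y hy), fun x y a b ha hb hab => ?_⟩
  · rw [← Set.piecewise_eq_indicator]
    exact ContinuousOn.measurable_piecewise (hc.mono subset_closure) continuousOn_const
      hΩo.measurableSet
  · obtain ⟨M, hM⟩ := hΩb.isCompact_closure.exists_bound_of_continuousOn hc
    refine ⟨max M 0, fun x => ?_⟩
    by_cases hx : x ∈ Ω
    · rw [Set.indicator_of_mem hx]
      exact ((le_abs_self _).trans (hM x (subset_closure hx))).trans (le_max_left _ _)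
    · rw [Set.indicator_of_notMem hx]
      exact le_max_right _ _
  · by_cases hx : x ∈ Ω
    swap
    · rw [Set.indicator_of_notMem hx, zero_rpow ha.ne', zero_mul]
      exact Set.indicator_nonneg (fun x _ => hnn x) _
    by_cases hy : y ∈ Ω
    swap
    · rw [Set.indicator_of_notMem hy, zero_rpow hb.ne', mul_zero]
      exact Set.indicator_nonneg (fun x _ => hnn x) _
    have hz := hlc.1 hx hy ha.le hb.le hab
    have hlog : ∀ z ∈ Ω, log (gaussDensity n z * g z ^ 2) =
        log ((2 * π) ^ (-(n : ℝ) / 2)) - ‖z‖ ^ 2 / 2 + 2 * log (g z) := fun z hz => by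
      rw [log_mul (gaussDensity_pos z).ne' (pow_pos (hpos z hz) 2).ne', log_gaussDensity, log_pow]
      norm_num
    have hp : ∀ z ∈ Ω, 0 < gaussDensity n z * g z ^ 2 := fun z hz =>
      mul_pos (gaussDensity_pos z) (pow_pos (hpos z hz) 2)
    rw [Set.indicator_of_mem hx, Set.indicator_of_mem hy, Set.indicator_of_mem hz]
    have px := rpow_pos_of_pos (hp x hx) a
    have py := rpow_pos_of_pos (hp y hy) b
    rw [← log_le_log_iff (mul_pos px py) (hp _ hz), log_mul px.ne' py.ne', log_rpow (hp x hx),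
      log_rpow (hp y hy), hlog x hx, hlog y hy, hlog _ hz]
    have h1 := hlc.2 hx hy ha.le hb.le hab
    simp only [smul_eq_mul] at h1
    have h2 : ‖a • x + b • y‖ ^ 2 ≤ a * ‖x‖ ^ 2 + b * ‖y‖ ^ 2 := by
      have h3 : ‖a • x + b • y‖ ≤ a * ‖x‖ + b * ‖y‖ := (norm_add_le _ _).trans_eq (by
        rw [norm_smul, norm_smul, Real.norm_of_nonneg ha.le, Real.norm_of_nonneg hb.le])
      have h4 : (a * ‖x‖ + b * ‖y‖) ^ 2 ≤ a * ‖x‖ ^ 2 + b * ‖y‖ ^ 2 := by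
        obtain rfl : b = 1 - a := by linarith
        nlinarith [mul_nonneg (mul_nonneg ha.le hb.le) (sq_nonneg (‖x‖ - ‖y‖))]
      exact (pow_le_pow_left₀ (norm_nonneg _) h3 2).trans h4
    have h5 : a * log ((2 * π) ^ (-(n : ℝ) / 2)) + b * log ((2 * π) ^ (-(n : ℝ) / 2)) =
        log ((2 * π) ^ (-(n : ℝ) / 2)) := by rw [← add_mul, hab, one_mul]
    linarith

end Gaussian

/-- The sharp Payne–Weinberger inequality for log-concave weights. -/
theorem IsLogConcaveWeight.exists_const_poincare {n : ℕ}
    {w : EuclideanSpace ℝ (Fin (n + 1)) → ℝ} {d : ℝ} (hd : 0 ≤ d) (hw : IsLogConcaveWeight w d)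
    {f : EuclideanSpace ℝ (Fin (n + 1)) → ℝ} (hf : ContDiff ℝ 1 f) :
    ∃ c : ℝ, (π / d) ^ 2 * ∫ x, (f x - c) ^ 2 * w x ≤ ∫ x, ‖fderiv ℝ f x‖ ^ 2 * w x := by
  have hD : 0 ≤ ∫ x, ‖fderiv ℝ f x‖ ^ 2 * w x :=
    integral_nonneg fun x => mul_nonneg (sq_nonneg _) (hw.nonneg x)
  have i0 := hw.integrable volume
  rcases (integral_nonneg hw.nonneg : 0 ≤ ∫ x, w x).eq_or_lt with h0 | h0
  · refine ⟨0, ?_⟩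
    have hae := (integral_eq_zero_iff_of_nonneg hw.nonneg i0).1 h0.symm
    rw [integral_eq_zero_of_ae (by
      filter_upwards [hae] with x hx
      simp [hx]), mul_zero]
    exact hD
  have i1 := hw.integrable_mul volume hf.continuous
  set c := (∫ x, f x * w x) / ∫ x, w x with hc
  have hcw : c * ∫ x, w x = ∫ x, f x * w x := div_mul_cancel₀ _ h0.ne'
  refine ⟨c, ?_⟩
  have hm : ∫ x, (f x - c) * w x = 0 := by
    simp only [sub_mul]
    rw [integral_sub i1 (i0.const_mul c), integral_const_mul, hcw, sub_self]
  rcases hd.eq_or_lt with rfl | hd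
  · simpa using hD
  have key : ∀ k, 0 < k → k < π / d →
      k ^ 2 * ∫ x, (f x - c) ^ 2 * w x ≤ ∫ x, ‖fderiv ℝ f x‖ ^ 2 * w x := fun k hk hkd => by
    have := hasLogConcavePoincare_euclideanSpace hk ((lt_div_iff₀ hd).1 hkd) n w
      (fun x => f x - c) hw (hf.sub contDiff_const)
    simp only [fderiv_sub_const, hm] at this
    refine le_of_mul_le_mul_left (le_of_eq_of_le ?_ this) h0
    ring
  have hlim : Tendsto (fun k : ℝ => k ^ 2 * ∫ x, (f x - c) ^ 2 * w x)
      (nhdsWithin (π / d) (Set.Iio (π / d))) (nhds ((π / d) ^ 2 * ∫ x, (f x - c) ^ 2 * w x)) := by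
    have : Continuous fun k : ℝ => k ^ 2 * ∫ x, (f x - c) ^ 2 * w x := by fun_prop
    exact (this.tendsto _).mono_left nhdsWithin_le_nhds
  refine le_of_tendsto hlim ?_
  filter_upwards [Ioo_mem_nhdsLT (show 0 < π / d by positivity)] with k hk
  exact key k hk.1 hk.2

/-- Picone's identity for `u = g * v`. -/
theorem norm_gradient_sq_sub_inner_gradient {E : Type*} [NormedAddCommGroup E]
    [InnerProductSpace ℝ E] [CompleteSpace E] {g u v : E → ℝ} {x : E}
    (hg : DifferentiableAt ℝ g x) (hv : DifferentiableAt ℝ v x)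
    (huv : u =ᶠ[nhds x] fun y => g y * v y) :
    ‖gradient u x‖ ^ 2 - ⟪gradient g x, gradient (fun y => u y * v y) x⟫ =
      g x ^ 2 * ‖gradient v x‖ ^ 2 := by
  have mulgrad : ∀ {a b : E → ℝ}, DifferentiableAt ℝ a x → DifferentiableAt ℝ b x →
      gradient (fun y => a y * b y) x = a x • gradient b x + b x • gradient a x :=
    fun {a b} ha hb => by
      rw [gradient, fderiv_fun_mul ha hb]
      simp [gradient]
  have hu : DifferentiableAt ℝ u x := huv.differentiableAt_iff.2 (hg.mul hv)
  have e1 : gradient u x = g x • gradient v x + v x • gradient g x := by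
    rw [← mulgrad hg hv, gradient, gradient, huv.fderiv_eq]
  rw [mulgrad hu hv, e1, huv.eq_of_nhds, norm_add_sq_real]
  simp only [norm_smul, inner_add_right, inner_smul_right, inner_smul_left, mul_pow, norm_eq_abs,
    sq_abs, real_inner_self_eq_norm_sq, real_inner_comm (gradient v x), conj_trivial]
  ring

/-- Stability of the Gaussian `L²`-Poincaré inequality on a bounded convex domain, with the
explicit constant `(π / diam Ω)²`.  The first Dirichlet eigenfunction `u₁^γ` of the
Ornstein–Uhlenbeck operator is positive in `Ω`, `C¹` in `Ω`, continuous up to and vanishing on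
the boundary, a weak solution of the Gaussian eigenvalue equation, and `log u₁^γ` is concave
(Colesanti–Qin–Salani). -/
theorem stability_gauss_L2_poincare
    {n : ℕ} (hn : 2 ≤ n)
    {Ω : Set (EuclideanSpace ℝ (Fin n))}
    (hΩo : IsOpen Ω) (hΩb : Bornology.IsBounded Ω) (hΩc : Convex ℝ Ω)
    (u₁ : EuclideanSpace ℝ (Fin n) → ℝ)
    (hu₁C : ContDiffOn ℝ 1 u₁ Ω)
    (hu₁pos : ∀ x ∈ Ω, 0 < u₁ x)
    (hu₁cont : ContinuousOn u₁ (closure Ω))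
    (hu₁bd : ∀ x ∈ frontier Ω, u₁ x = 0)
    (hu₁eig : ∀ φ : EuclideanSpace ℝ (Fin n) → ℝ,
      ContDiff ℝ (⊤ : ℕ∞) φ → HasCompactSupport φ → tsupport φ ⊆ Ω →
      ∫ x in Ω, ⟪gradient u₁ x, gradient φ x⟫ ∂(gaussMeasure n)
        = lambda1Gauss n Ω * ∫ x in Ω, u₁ x * φ x ∂(gaussMeasure n))
    (hu₁lc : ConcaveOn ℝ Ω fun x => Real.log (u₁ x))
    (u : EuclideanSpace ℝ (Fin n) → ℝ)
    (huC : ContDiff ℝ (⊤ : ℕ∞) u) (huK : HasCompactSupport u) (huS : tsupport u ⊆ Ω) :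
    (∫ x in Ω, ‖gradient u x‖ ^ 2 ∂(gaussMeasure n))
        - lambda1Gauss n Ω * ∫ x in Ω, |u x| ^ 2 ∂(gaussMeasure n)
      ≥ (Real.pi / Metric.diam Ω) ^ 2 *
        ⨅ c : ℝ, ∫ x in Ω, |u x - c * u₁ x| ^ 2 ∂(gaussMeasure n) := by
  obtain ⟨m, rfl⟩ : ∃ m, n = m + 1 := ⟨n - 1, by omega⟩
  have hΩm := hΩo.measurableSet
  have hu : ContDiff ℝ 1 u := huC.of_le (by exact_mod_cast le_top)
  set v : EuclideanSpace ℝ (Fin (m + 1)) → ℝ := fun x => u x / u₁ x with hvdef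
  have hvsupp : tsupport v ⊆ tsupport u := by
    refine closure_mono fun x hx hux => hx ?_
    simp [hvdef, hux]
  have hu₁at : ∀ x ∈ Ω, ContDiffAt ℝ 1 u₁ x := fun x hx => hu₁C.contDiffAt (hΩo.mem_nhds hx)
  have hv : ContDiff ℝ 1 v := contDiff_iff_contDiffAt.2 fun x => by
    by_cases hx : x ∈ tsupport v
    · have hxΩ := huS (hvsupp hx)
      exact hu.contDiffAt.div (hu₁at x hxΩ) (hu₁pos x hxΩ).ne'
    · exact contDiffAt_const.congr_of_eventuallyEq (notMem_tsupport_iff_eventuallyEq.1 hx)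
  have huv : ∀ x ∈ Ω, u x = u₁ x * v x := fun x hx =>
    (mul_div_cancel₀ _ (hu₁pos x hx).ne').symm
  have hφK : tsupport (fun x => u x * v x) ⊆ tsupport u := by
    refine closure_mono fun x hx hux => hx ?_
    simp [hux]
  have hφ : ContDiff ℝ 1 fun x => u x * v x := hu.mul hv
  have cgrad : ∀ {ψ : EuclideanSpace ℝ (Fin (m + 1)) → ℝ}, ContDiff ℝ 1 ψ →
      Continuous (gradient ψ) := fun {ψ} hψ =>
    (InnerProductSpace.toDual ℝ _).symm.continuous.comp (hψ.continuous_fderiv (by norm_num))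
  have cg₁ : ContinuousOn (gradient u₁) Ω :=
    (InnerProductSpace.toDual ℝ _).symm.continuous.comp_continuousOn
      (hu₁C.continuousOn_fderiv_of_isOpen hΩo le_rfl)
  have hzero : ∀ {ψ : EuclideanSpace ℝ (Fin (m + 1)) → ℝ}, tsupport ψ ⊆ tsupport u →
      ∀ x ∉ tsupport u, gradient ψ x = 0 := fun {ψ} hψ x hx => by
    rw [gradient, (notMem_tsupport_iff_eventuallyEq.1 fun h => hx (hψ h)).fderiv_eq]
    simp
  have hweak : ∫ x in Ω, ⟪gradient u₁ x, gradient (fun y => u y * v y) x⟫ ∂(gaussMeasure (m + 1)) =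
      lambda1Gauss (m + 1) Ω * ∫ x in Ω, |u x| ^ 2 ∂(gaussMeasure (m + 1)) := by
    rw [setIntegral_eq_of_contDiff_one hΩo cg₁ (h := fun x => lambda1Gauss (m + 1) Ω * u₁ x)
      (continuousOn_const.mul hu₁C.continuousOn) (fun ψ h1 h2 h3 => by
        rw [hu₁eig ψ h1 h2 h3, ← integral_const_mul]
        simp only [mul_assoc]) hφ (huK.mono' ((subset_tsupport _).trans hφK)) (hφK.trans huS),
      ← integral_const_mul]
    refine setIntegral_congr_fun hΩm fun x hx => ?_
    simp only [sq_abs]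
    rw [pow_two]
    nth_rewrite 2 [huv x hx]
    ring
  have hLHS : (∫ x in Ω, ‖gradient u x‖ ^ 2 ∂(gaussMeasure (m + 1)))
        - lambda1Gauss (m + 1) Ω * ∫ x in Ω, |u x| ^ 2 ∂(gaussMeasure (m + 1)) =
      ∫ x, ‖fderiv ℝ v x‖ ^ 2 * Ω.indicator (fun x => gaussDensity (m + 1) x * u₁ x ^ 2) x := by
    have i1 : IntegrableOn (fun x => ‖gradient u x‖ ^ 2) Ω (gaussMeasure (m + 1)) :=
      ((((cgrad hu).norm.pow 2).continuousOn.integrableOn_compact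
        huK).integrable_of_forall_notMem_eq_zero
        fun x hx => by simp [hzero subset_rfl x hx]).integrableOn
    have i2 : IntegrableOn (fun x => ⟪gradient u₁ x, gradient (fun y => u y * v y) x⟫) Ω
        (gaussMeasure (m + 1)) :=
      ((((cg₁.mono huS).inner (cgrad hφ).continuousOn).integrableOn_compact
        huK).integrable_of_forall_notMem_eq_zero
        fun x hx => by simp [hzero hφK x hx]).integrableOn
    rw [← hweak, ← integral_sub i1 i2, setIntegral_gaussMeasure hΩm, ← integral_indicator hΩm]
    refine integral_congr_ae (Eventually.of_forall fun x => ?_)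
    by_cases hx : x ∈ Ω
    · simp only [Set.indicator_of_mem hx]
      rw [norm_gradient_sq_sub_inner_gradient ((hu₁at x hx).differentiableAt one_ne_zero)
        (hv.differentiable one_ne_zero x)
        (by filter_upwards [hΩo.mem_nhds hx] with y hy using huv y hy), gradient,
        LinearIsometryEquiv.norm_map]
      ring
    · simp [Set.indicator_of_notMem hx]
  obtain ⟨c, hc⟩ := (isLogConcaveWeight_gaussDensity_mul_sq hΩo hΩb hu₁pos hu₁cont
    hu₁lc).exists_const_poincare Metric.diam_nonneg hv
  have hRHS : ∫ x, (v x - c) ^ 2 * Ω.indicator (fun x => gaussDensity (m + 1) x * u₁ x ^ 2) x =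
      ∫ x in Ω, |u x - c * u₁ x| ^ 2 ∂(gaussMeasure (m + 1)) := by
    rw [setIntegral_gaussMeasure hΩm, ← integral_indicator hΩm]
    refine integral_congr_ae (Eventually.of_forall fun x => ?_)
    by_cases hx : x ∈ Ω
    · simp only [Set.indicator_of_mem hx, sq_abs]
      rw [huv x hx]
      ring
    · simp [Set.indicator_of_notMem hx]
  rw [ge_iff_le, hLHS]
  refine le_trans (mul_le_mul_of_nonneg_left ?_ (sq_nonneg _)) hc
  rw [hRHS]
  exact ciInf_le ⟨0, by rintro _ ⟨c, rfl⟩; exact integral_nonneg fun x => sq_nonneg _⟩ c
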